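/- arXiv:2301.04689 — 5 statements merged into one kernel-verified Lean document; each statement's English description precedes it below -/
import Mathlib

section
/- For all real numbers t, s with 0 < s < t and all u ≥ 0, one has G_t(s,u) ≤ (3/(4√π)) · (√t / √(s(t−s))) · (dP^Dir_t(u,0))², where G_t(s,u) = ∫₀^∞ (P^Dir_{t−s}(u,v))² (dP^Dir_s(v,0))² dv. -/
open MeasureTheory Real

/-- Half-space Dirichlet heat kernel. -/
noncomputable def PDir (t u v : ℝ) : ℝ :=
  (Real.sqrt (2 * Real.pi * t))⁻¹ *
    (Real.exp (-(u - v) ^ 2 / (2 * t)) - Real.exp (-(u + v) ^ 2 / (2 * t)))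

/-- `dP^Dir_t(u,0) = 2√(2/π) u e^{-u²/(2t)} t^{-3/2}`. -/
noncomputable def dPDir (t u : ℝ) : ℝ :=
  2 * Real.sqrt (2 / Real.pi) * u * Real.exp (-u ^ 2 / (2 * t)) / t ^ (3 / 2 : ℝ)

/-- `G_t(s,u) = ∫₀^∞ (P^Dir_{t−s}(u,v))² (dP^Dir_s(v,0))² dv`. -/
noncomputable def Gt (t s u : ℝ) : ℝ :=
  ∫ v in Set.Ioi (0 : ℝ), (PDir (t - s) u v) ^ 2 * (dPDir s v) ^ 2

open ProbabilityTheory in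
/-- Second moment of an unnormalised Gaussian, as an integral against Lebesgue measure. -/
lemma integrable_and_integral_sq_mul_exp_neg_mul_sub_sq {b : ℝ} (hb : 0 < b) (m : ℝ) :
    Integrable (fun v : ℝ => v ^ 2 * Real.exp (-b * (v - m) ^ 2)) ∧
      ∫ v : ℝ, v ^ 2 * Real.exp (-b * (v - m) ^ 2) =
        Real.sqrt (Real.pi / b) * (1 / (2 * b) + m ^ 2) := by
  have hσ : (0 : ℝ) < 1 / (2 * b) := by positivity
  lift 1 / (2 * b) to NNReal using hσ.le with σ hσb
  have hσ0 : σ ≠ 0 := fun h => by simp [h] at hσ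
  have hsqrt : Real.sqrt (Real.pi / b) = Real.sqrt (2 * Real.pi * σ) := by
    congr 1; rw [hσb]; field_simp
  have hpos : 0 < Real.sqrt (2 * Real.pi * σ) := by positivity
  have hpdf : ∀ v : ℝ, v ^ 2 * Real.exp (-b * (v - m) ^ 2) =
      Real.sqrt (2 * Real.pi * σ) * (gaussianPDFReal m σ v • v ^ 2) := by
    intro v
    have h : -(v - m) ^ 2 / (2 * (σ : ℝ)) = -b * (v - m) ^ 2 := by
      rw [hσb]; field_simp
    rw [gaussianPDFReal, h, smul_eq_mul]
    field_simp
  have hmem : MemLp (fun v : ℝ => v) 2 (gaussianReal m σ) := memLp_id_gaussianReal 2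
  have hmoment : ∫ v : ℝ, v ^ 2 ∂(gaussianReal m σ) = σ + m ^ 2 := by
    have h := variance_eq_sub hmem
    rw [variance_fun_id_gaussianReal, integral_id_gaussianReal] at h
    simp only [Pi.pow_apply] at h
    linarith
  have hint : ∫ v : ℝ, v ^ 2 * Real.exp (-b * (v - m) ^ 2) =
      Real.sqrt (Real.pi / b) * (σ + m ^ 2) := by
    simp_rw [hpdf]
    rw [integral_const_mul, ← integral_gaussianReal_eq_integral_smul hσ0, hmoment, hsqrt]
  refine ⟨?_, hint⟩
  by_contra hn
  rw [integral_undef hn, hsqrt] at hint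
  have : 0 < Real.sqrt (2 * Real.pi * σ) * (σ + m ^ 2) := by positivity
  exact this.ne hint

/-- Completing the squares in the integrand of `Gt`. -/
lemma PDir_sq_mul_dPDir_sq {t s : ℝ} (hs : 0 < s) (hst : s < t) (u v : ℝ) :
    (PDir (t - s) u v) ^ 2 * (dPDir s v) ^ 2 =
      4 / (Real.pi ^ 2 * (t - s) * s ^ 3) *
        (Real.exp (-u ^ 2 / t) *
            (v ^ 2 * Real.exp (-(t / ((t - s) * s)) * (v - u * s / t) ^ 2) +
              v ^ 2 * Real.exp (-(t / ((t - s) * s)) * (v - -(u * s / t)) ^ 2)) -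
          2 * Real.exp (-u ^ 2 / (t - s)) *
            (v ^ 2 * Real.exp (-(t / ((t - s) * s)) * (v - 0) ^ 2))) := by
  obtain ⟨a, rfl⟩ : ∃ a, t = s + a := ⟨t - s, by ring⟩
  have ha : 0 < a := by linarith
  have ht : 0 < s + a := by linarith
  rw [add_sub_cancel_left]
  have h32 : (s ^ (3 / 2 : ℝ)) ^ 2 = s ^ 3 := by
    rw [← Real.rpow_natCast, ← Real.rpow_mul hs.le]
    norm_num
  have e1 : Real.exp (-u ^ 2 / (s + a)) *
        Real.exp (-((s + a) / (a * s)) * (v - u * s / (s + a)) ^ 2) =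
      Real.exp (-(u - v) ^ 2 / (2 * a)) ^ 2 * Real.exp (-v ^ 2 / (2 * s)) ^ 2 := by
    simp only [← Real.exp_add, ← Real.exp_nat_mul]
    congr 1; push_cast; field_simp; ring
  have e2 : Real.exp (-u ^ 2 / (s + a)) *
        Real.exp (-((s + a) / (a * s)) * (v - -(u * s / (s + a))) ^ 2) =
      Real.exp (-(u + v) ^ 2 / (2 * a)) ^ 2 * Real.exp (-v ^ 2 / (2 * s)) ^ 2 := by
    simp only [← Real.exp_add, ← Real.exp_nat_mul]
    congr 1; push_cast; field_simp; ring
  have e3 : Real.exp (-u ^ 2 / a) * Real.exp (-((s + a) / (a * s)) * (v - 0) ^ 2) =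
      Real.exp (-(u - v) ^ 2 / (2 * a)) * Real.exp (-(u + v) ^ 2 / (2 * a)) *
        Real.exp (-v ^ 2 / (2 * s)) ^ 2 := by
    simp only [← Real.exp_add, ← Real.exp_nat_mul]
    congr 1; push_cast; field_simp; ring
  have hP : (Real.sqrt (2 * Real.pi * a))⁻¹ ^ 2 = (2 * Real.pi * a)⁻¹ := by
    rw [inv_pow, Real.sq_sqrt (by positivity)]
  have hQ : Real.sqrt (2 / Real.pi) ^ 2 = 2 / Real.pi := Real.sq_sqrt (by positivity)
  rw [PDir, dPDir]
  simp only [mul_pow, div_pow, hP, hQ, h32]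
  calc _ = 4 / (Real.pi ^ 2 * a * s ^ 3) * v ^ 2 *
        (Real.exp (-(u - v) ^ 2 / (2 * a)) ^ 2 * Real.exp (-v ^ 2 / (2 * s)) ^ 2 +
          Real.exp (-(u + v) ^ 2 / (2 * a)) ^ 2 * Real.exp (-v ^ 2 / (2 * s)) ^ 2 -
          2 * (Real.exp (-(u - v) ^ 2 / (2 * a)) * Real.exp (-(u + v) ^ 2 / (2 * a)) *
            Real.exp (-v ^ 2 / (2 * s)) ^ 2)) := by
        field_simp; ring
    _ = _ := by rw [← e1, ← e2, ← e3]; ring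

/-- Closed form of `Gt`. -/
lemma Gt_eq {t s : ℝ} (hs : 0 < s) (hst : s < t) (u : ℝ) :
    Gt t s u = 4 / (Real.pi ^ 2 * (t - s) * s ^ 3) *
      Real.sqrt (Real.pi / (t / ((t - s) * s))) *
        (Real.exp (-u ^ 2 / t) * (1 / (2 * (t / ((t - s) * s))) + (u * s / t) ^ 2) -
          Real.exp (-u ^ 2 / (t - s)) * (1 / (2 * (t / ((t - s) * s))))) := by
  have ha : 0 < t - s := sub_pos.2 hst
  have ht : 0 < t := hs.trans hst
  have hb : 0 < t / ((t - s) * s) := by positivity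
  have heven : 2 * Gt t s u = ∫ v : ℝ, (PDir (t - s) u v) ^ 2 * (dPDir s v) ^ 2 := by
    rw [Gt, ← integral_comp_abs (f := fun v => (PDir (t - s) u v) ^ 2 * (dPDir s v) ^ 2)]
    congr 1
    funext v
    rcases abs_choice v with h | h <;> rw [h]
    simp only [PDir_sq_mul_dPDir_sq hs hst]
    ring_nf
  simp_rw [PDir_sq_mul_dPDir_sq hs hst] at heven
  obtain ⟨i1, h1⟩ := integrable_and_integral_sq_mul_exp_neg_mul_sub_sq hb (u * s / t)
  obtain ⟨i2, h2⟩ := integrable_and_integral_sq_mul_exp_neg_mul_sub_sq hb (-(u * s / t))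
  obtain ⟨i3, h3⟩ := integrable_and_integral_sq_mul_exp_neg_mul_sub_sq hb 0
  rw [integral_const_mul, integral_sub ((i1.fun_add i2).const_mul _) (i3.const_mul _),
    integral_const_mul, integral_const_mul, integral_add i1 i2, h1, h2, h3] at heven
  linear_combination heven / 2

theorem stmt1 (t s u : ℝ) (hs : 0 < s) (hst : s < t) (hu : 0 ≤ u) :
    Gt t s u ≤ (3 / (4 * Real.sqrt Real.pi)) * (Real.sqrt t / Real.sqrt (s * (t - s))) *
      (dPDir t u) ^ 2 := by
  rw [Gt_eq hs hst]
  have ht : 0 < t := hs.trans hst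
  obtain ⟨a, ha, rfl⟩ : ∃ a, 0 < a ∧ t = s + a := ⟨t - s, sub_pos.2 hst, by ring⟩
  rw [add_sub_cancel_left]
  have h32 : ((s + a) ^ (3 / 2 : ℝ)) ^ 2 = (s + a) ^ 3 := by
    rw [← Real.rpow_natCast, ← Real.rpow_mul ht.le]
    norm_num
  have hexp : Real.exp (-u ^ 2 / (s + a)) * (1 - u ^ 2 * s / (a * (s + a))) ≤
      Real.exp (-u ^ 2 / a) := by
    have h : -u ^ 2 / a = -u ^ 2 / (s + a) + -(u ^ 2 * s / (a * (s + a))) := by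
      field_simp; ring
    rw [h, Real.exp_add]
    gcongr
    linarith [Real.add_one_le_exp (-(u ^ 2 * s / (a * (s + a))))]
  have hsq : Real.exp (-u ^ 2 / (2 * (s + a))) ^ 2 = Real.exp (-u ^ 2 / (s + a)) := by
    rw [← Real.exp_nat_mul]; congr 1; push_cast; field_simp
  have hroot : Real.sqrt (Real.pi / ((s + a) / (a * s))) =
      Real.sqrt Real.pi * Real.sqrt (s * a) / Real.sqrt (s + a) := by
    rw [← Real.sqrt_mul Real.pi_pos.le, ← Real.sqrt_div (by positivity)]
    congr 1; field_simp
  have hQ : Real.sqrt (2 / Real.pi) ^ 2 = 2 / Real.pi := Real.sq_sqrt (by positivity)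
  calc _ ≤ 4 / (Real.pi ^ 2 * a * s ^ 3) * Real.sqrt (Real.pi / ((s + a) / (a * s))) *
        (Real.exp (-u ^ 2 / (s + a)) * (1 / (2 * ((s + a) / (a * s))) + (u * s / (s + a)) ^ 2) -
          Real.exp (-u ^ 2 / (s + a)) * (1 - u ^ 2 * s / (a * (s + a))) *
            (1 / (2 * ((s + a) / (a * s))))) := by gcongr
    _ = _ := by
      rw [hroot, dPDir, mul_comm s a]
      simp only [mul_pow, div_pow, h32, hQ, hsq]
      have p1 : Real.sqrt Real.pi ^ 2 = Real.pi := Real.sq_sqrt Real.pi_pos.le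
      have p2 : Real.sqrt (a * s) ^ 2 = a * s := Real.sq_sqrt (by positivity)
      have p3 : Real.sqrt (s + a) ^ 2 = s + a := Real.sq_sqrt ht.le
      have q1 : 0 < Real.sqrt Real.pi := by positivity
      have q2 : 0 < Real.sqrt (a * s) := by positivity
      have q3 : 0 < Real.sqrt (s + a) := by positivity
      generalize Real.exp (-u ^ 2 / (s + a)) = E
      field_simp
      rw [p1, p2, p3]
      ring
end

section
/- For every fixed t > 0 and u ≥ 0, the limit as ε → 0⁺ of (1/(2π)) ∫_{−πε^{−2}}^{πε^{−2}} exp( (cos(ε²θ) − 1) ε^{−4} t ) · e^{iθu} · F_ε(θ) dθ exists and equals 2√(2/π) · u · e^{−u²/(2t)} · t^{−3/2}. -/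
open MeasureTheory Real Complex Filter

/-- `F_ε(θ) = (1−e^{−2ε})(1−e^{2iε²θ}) / ( (1−e^{−ε−iε²θ}) (1−e^{−ε+iε²θ})² )`. -/
noncomputable def Feps (ε θ : ℝ) : ℂ :=
  (((1 - Real.exp (-2 * ε) : ℝ) : ℂ) * (1 - Complex.exp (2 * Complex.I * (ε : ℂ) ^ 2 * (θ : ℂ)))) /
    ((1 - Complex.exp (-(ε : ℂ) - Complex.I * (ε : ℂ) ^ 2 * (θ : ℂ))) *
      (1 - Complex.exp (-(ε : ℂ) + Complex.I * (ε : ℂ) ^ 2 * (θ : ℂ))) ^ 2)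

/-- The integrand of the oscillatory integral attached to `Feps`. -/
noncomputable def oscIntegrand (t u ε θ : ℝ) : ℂ :=
  ((Real.exp ((Real.cos (ε ^ 2 * θ) - 1) * t / ε ^ 4) : ℝ) : ℂ) *
    Complex.exp (Complex.I * (θ : ℂ) * (u : ℂ)) * Feps ε θ

theorem tendsto_sq_nhdsGT_zero :
    Tendsto (fun ε : ℝ => ε ^ 2) (nhdsWithin 0 (Set.Ioi 0)) (nhdsWithin 0 (Set.Ioi 0)) := by
  refine tendsto_nhdsWithin_iff.2 ⟨?_, ?_⟩
  · have h : Tendsto (fun ε : ℝ => ε ^ 2) (nhds 0) (nhds (0 ^ 2)) :=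
      (continuous_pow 2).tendsto 0
    rw [zero_pow two_ne_zero] at h
    exact h.mono_left nhdsWithin_le_nhds
  · filter_upwards [self_mem_nhdsWithin] with ε hε
    exact pow_pos (Set.mem_Ioi.1 hε) 2

theorem HasDerivAt.tendsto_div_nhdsGT_zero {f : ℝ → ℂ} {f' : ℂ} (hf : HasDerivAt f f' 0)
    (h0 : f 0 = 0) :
    Tendsto (fun ε : ℝ => f ε / (ε : ℂ)) (nhdsWithin 0 (Set.Ioi 0)) (nhds f') := by
  refine hf.tendsto_slope_zero_right.congr fun ε => ?_
  rw [zero_add, h0, sub_zero, Complex.real_smul, Complex.ofReal_inv, div_eq_inv_mul]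

theorem tendsto_one_sub_exp_div (c : ℂ) :
    Tendsto (fun ε : ℝ => (1 - Complex.exp (-(ε : ℂ) + c * (ε : ℂ) ^ 2)) / (ε : ℂ))
      (nhdsWithin 0 (Set.Ioi 0)) (nhds 1) := by
  refine HasDerivAt.tendsto_div_nhdsGT_zero ?_ (by simp)
  have h1 : HasDerivAt (fun x : ℝ => (x : ℂ)) 1 0 := Complex.ofRealCLM.hasDerivAt
  have h2 := ((h1.neg.add ((h1.pow 2).const_mul c)).cexp).const_sub 1
  exact h2.congr_deriv (by simp)

theorem tendsto_Feps (θ : ℝ) :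
    Tendsto (fun ε : ℝ => Feps ε θ) (nhdsWithin 0 (Set.Ioi 0))
      (nhds (-4 * Complex.I * (θ : ℂ))) := by
  have h1 : HasDerivAt (fun x : ℝ => (x : ℂ)) 1 0 := Complex.ofRealCLM.hasDerivAt
  have hA : Tendsto (fun ε : ℝ => (1 - Complex.exp (-2 * (ε : ℂ))) / (ε : ℂ))
      (nhdsWithin 0 (Set.Ioi 0)) (nhds 2) := by
    refine HasDerivAt.tendsto_div_nhdsGT_zero ?_ (by simp)
    exact (((h1.const_mul (-2 : ℂ)).cexp).const_sub 1).congr_deriv (by simp)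
  have hB : Tendsto (fun s : ℝ => (1 - Complex.exp (2 * Complex.I * (θ : ℂ) * (s : ℂ))) / (s : ℂ))
      (nhdsWithin 0 (Set.Ioi 0)) (nhds (-2 * Complex.I * θ)) := by
    refine HasDerivAt.tendsto_div_nhdsGT_zero ?_ (by simp)
    exact (((h1.const_mul (2 * Complex.I * (θ : ℂ))).cexp).const_sub 1).congr_deriv (by simp)
  have hC := tendsto_one_sub_exp_div (-(Complex.I * θ))
  have hD := tendsto_one_sub_exp_div (Complex.I * θ)
  have h := (hA.mul (hB.comp tendsto_sq_nhdsGT_zero)).div (hC.mul (hD.pow 2)) (by simp)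
  have hlim : 2 * (-2 * Complex.I * (θ : ℂ)) / (1 * 1 ^ 2) = -4 * Complex.I * (θ : ℂ) := by ring
  rw [hlim] at h
  refine h.congr' ?_
  filter_upwards [self_mem_nhdsWithin] with ε hε
  have hε' : (ε : ℂ) ≠ 0 := Complex.ofReal_ne_zero.2 (ne_of_gt hε)
  have e1 : -(ε : ℂ) + -(Complex.I * θ) * (ε : ℂ) ^ 2
      = -(ε : ℂ) - Complex.I * (ε : ℂ) ^ 2 * (θ : ℂ) := by ring
  have e2 : -(ε : ℂ) + Complex.I * θ * (ε : ℂ) ^ 2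
      = -(ε : ℂ) + Complex.I * (ε : ℂ) ^ 2 * (θ : ℂ) := by ring
  have e3 : 2 * Complex.I * (θ : ℂ) * (ε : ℂ) ^ 2
      = 2 * Complex.I * (ε : ℂ) ^ 2 * (θ : ℂ) := by ring
  simp only [Feps, Pi.div_apply, Function.comp_apply, Complex.ofReal_pow, e1, e2, e3,
    Complex.ofReal_sub, Complex.ofReal_one, Complex.ofReal_exp, Complex.ofReal_mul,
    Complex.ofReal_neg, Complex.ofReal_ofNat]
  rw [div_mul_div_comm, div_pow, div_mul_div_comm, div_div_div_eq,
    show (ε : ℂ) * (ε : ℂ) ^ 2 = (ε : ℂ) ^ 3 by ring, mul_comm ((ε : ℂ) ^ 3),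
    mul_div_mul_right _ _ (pow_ne_zero 3 hε')]

theorem tendsto_cos_sub_one_mul_div (t θ : ℝ) :
    Tendsto (fun ε : ℝ => (Real.cos (ε ^ 2 * θ) - 1) * t / ε ^ 4) (nhdsWithin 0 (Set.Ioi 0))
      (nhds (-(t / 2) * θ ^ 2)) := by
  have hs : Tendsto (fun s : ℝ => Real.sin (s * (θ / 2)) / s) (nhdsWithin 0 (Set.Ioi 0))
      (nhds (θ / 2)) := by
    have hd : HasDerivAt (fun s : ℝ => Real.sin (s * (θ / 2))) (θ / 2) 0 := by
      simpa using ((hasDerivAt_id (0 : ℝ)).mul_const (θ / 2)).sin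
    refine hd.tendsto_slope_zero_right.congr fun s => ?_
    simp [div_eq_inv_mul]
  have h := ((hs.comp tendsto_sq_nhdsGT_zero).pow 2).const_mul (-2 * t)
  rw [show -2 * t * (θ / 2) ^ 2 = -(t / 2) * θ ^ 2 by ring] at h
  refine h.congr fun ε => ?_
  have hc : Real.cos (ε ^ 2 * θ) = 1 - 2 * Real.sin (ε ^ 2 * (θ / 2)) ^ 2 := by
    rw [show ε ^ 2 * θ = 2 * (ε ^ 2 * (θ / 2)) by ring, Real.cos_two_mul, Real.cos_sq']
    ring
  rw [hc, Function.comp_apply, div_pow]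
  ring

theorem tendsto_oscIntegrand (t u θ : ℝ) :
    Tendsto (fun ε : ℝ => oscIntegrand t u ε θ) (nhdsWithin 0 (Set.Ioi 0))
      (nhds (((Real.exp (-(t / 2) * θ ^ 2) : ℝ) : ℂ) *
        Complex.exp (Complex.I * (θ : ℂ) * (u : ℂ)) * (-4 * Complex.I * (θ : ℂ)))) :=
  (((Complex.continuous_ofReal.tendsto _).comp ((Real.continuous_exp.tendsto _).comp
    (tendsto_cos_sub_one_mul_div t θ))).mul_const _).mul (tendsto_Feps θ)

theorem norm_Feps_le {ε : ℝ} (h0 : 0 < ε) (h1 : ε ≤ 1) (θ : ℝ) : ‖Feps ε θ‖ ≤ 32 * |θ| := by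
  have hexp : Real.exp (-ε) ≤ 1 - ε / 2 := by
    nlinarith [(abs_le.1 (Real.abs_exp_sub_one_sub_id_le
      (x := -ε) (by rwa [abs_neg, abs_of_pos h0]))).2, Real.add_one_le_exp ε,
      Real.exp_neg ε, Real.exp_pos (-ε), mul_inv_cancel₀ (Real.exp_pos ε).ne',
      Real.quadratic_le_exp_of_nonneg h0.le]
  have hden : ∀ z : ℂ, z.re = -ε → ε / 2 ≤ ‖1 - Complex.exp z‖ := fun z hz => by
    have h := norm_sub_norm_le (1 : ℂ) (Complex.exp z)
    rw [norm_one, Complex.norm_exp, hz] at h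
    linarith
  have hA : ‖((1 - Real.exp (-2 * ε) : ℝ) : ℂ)‖ ≤ 2 * ε := by
    rw [Complex.norm_real, Real.norm_eq_abs, abs_of_nonneg]
    · linarith [Real.add_one_le_exp (-2 * ε)]
    · linarith [Real.exp_le_one_iff.2 (show -2 * ε ≤ 0 by linarith)]
  have hB : ‖1 - Complex.exp (2 * Complex.I * (ε : ℂ) ^ 2 * (θ : ℂ))‖ ≤ 2 * ε ^ 2 * |θ| := by
    have h := Real.norm_exp_I_mul_ofReal_sub_one_le (x := 2 * ε ^ 2 * θ)
    rw [norm_sub_rev, Real.norm_eq_abs, abs_mul, abs_of_nonneg (by positivity : 0 ≤ 2 * ε ^ 2)] at h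
    rwa [show Complex.I * ((2 * ε ^ 2 * θ : ℝ) : ℂ) = 2 * Complex.I * (ε : ℂ) ^ 2 * (θ : ℂ) by
      push_cast; ring] at h
  have hC := hden (-(ε : ℂ) - Complex.I * (ε : ℂ) ^ 2 * (θ : ℂ))
    (by simp [← Complex.ofReal_pow])
  have hD := hden (-(ε : ℂ) + Complex.I * (ε : ℂ) ^ 2 * (θ : ℂ))
    (by simp [← Complex.ofReal_pow])
  rw [Feps, norm_div, norm_mul, norm_mul, norm_pow]
  calc _ ≤ (2 * ε * (2 * ε ^ 2 * |θ|)) / (ε / 2 * (ε / 2) ^ 2) := by gcongr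
    _ = 32 * |θ| := by field_simp; ring

theorem norm_oscIntegrand_le {t ε θ : ℝ} (ht : 0 < t) (u : ℝ) (h0 : 0 < ε) (h1 : ε ≤ 1)
    (hθ : θ ∈ Set.Ioo (-(Real.pi / ε ^ 2)) (Real.pi / ε ^ 2)) :
    ‖oscIntegrand t u ε θ‖ ≤ 32 * (|θ| * Real.exp (-(2 / Real.pi ^ 2 * t) * θ ^ 2)) := by
  have hε : 0 < ε ^ 2 := by positivity
  have habs : |ε ^ 2 * θ| ≤ Real.pi := by
    rw [abs_mul, abs_of_pos hε, mul_comm, ← le_div_iff₀ hε]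
    exact (abs_lt.2 hθ).le
  have hexp : (Real.cos (ε ^ 2 * θ) - 1) * t / ε ^ 4 ≤ -(2 / Real.pi ^ 2 * t) * θ ^ 2 := by
    rw [div_le_iff₀ (by positivity)]
    nlinarith [mul_le_mul_of_nonneg_right (Real.cos_le_one_sub_mul_cos_sq habs) ht.le]
  have hu : ‖Complex.exp (Complex.I * (θ : ℂ) * (u : ℂ))‖ = 1 := by
    rw [mul_assoc, ← Complex.ofReal_mul, Complex.norm_exp_I_mul_ofReal]
  rw [oscIntegrand, norm_mul, norm_mul, hu, mul_one, Complex.norm_real, Real.norm_eq_abs,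
    Real.abs_exp]
  calc _ ≤ Real.exp (-(2 / Real.pi ^ 2 * t) * θ ^ 2) * (32 * |θ|) := by
        gcongr
        exact norm_Feps_le h0 h1 θ
    _ = _ := by ring

theorem integrable_abs_mul_exp_neg_mul_sq {b : ℝ} (hb : 0 < b) :
    Integrable fun x : ℝ => |x| * Real.exp (-b * x ^ 2) := by
  simpa [abs_mul] using (integrable_mul_exp_neg_mul_sq hb).norm

theorem integral_mul_exp_mul_exp_neg_mul_sq {b : ℝ} (hb : 0 < b) (u : ℝ) :
    ∫ x : ℝ, (x : ℂ) * (Complex.exp (Complex.I * u * x) * Complex.exp (-b * (x : ℂ) ^ 2)) =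
      Complex.I * u / (2 * b) *
        ((Real.pi / b : ℂ) ^ (1 / 2 : ℂ) * Complex.exp (-(u : ℂ) ^ 2 / (4 * b))) := by
  have hb' : 0 < (b : ℂ).re := hb
  have hu (x : ℝ) : ‖Complex.exp (Complex.I * u * x)‖ = 1 := by
    rw [mul_assoc, ← Complex.ofReal_mul, Complex.norm_exp_I_mul_ofReal]
  have hm : AEStronglyMeasurable (fun x : ℝ => Complex.exp (Complex.I * u * x)) volume :=
    Continuous.aestronglyMeasurable (by fun_prop)
  have hg : Integrable fun x : ℝ =>
      Complex.exp (Complex.I * u * x) * Complex.exp (-b * (x : ℂ) ^ 2) :=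
    (integrable_cexp_neg_mul_sq hb').bdd_mul hm (c := 1) (.of_forall fun x => (hu x).le)
  have hxg : Integrable fun x : ℝ =>
      (x : ℂ) * (Complex.exp (Complex.I * u * x) * Complex.exp (-b * (x : ℂ) ^ 2)) := by
    refine ((integrable_mul_cexp_neg_mul_sq hb').bdd_mul hm (c := 1)
      (.of_forall fun x => (hu x).le)).congr (.of_forall fun x => ?_)
    simp only
    ring
  have hderiv (x : ℝ) : HasDerivAt
      (fun x : ℝ => Complex.exp (Complex.I * u * x) * Complex.exp (-b * (x : ℂ) ^ 2))
      (Complex.I * u * (Complex.exp (Complex.I * u * x) * Complex.exp (-b * (x : ℂ) ^ 2)) -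
        2 * b * (x * (Complex.exp (Complex.I * u * x) * Complex.exp (-b * (x : ℂ) ^ 2)))) x := by
    have h1 : HasDerivAt (fun x : ℝ => (x : ℂ)) 1 x := Complex.ofRealCLM.hasDerivAt
    refine ((h1.const_mul (Complex.I * (u : ℂ))).cexp.mul
      ((h1.pow 2).const_mul (-b : ℂ)).cexp).congr_deriv ?_
    simp
    ring
  have h0 := integral_eq_zero_of_hasDerivAt_of_integrable hderiv
    ((hg.const_mul _).sub (hxg.const_mul _)) hg
  rw [integral_sub (hg.const_mul _) (hxg.const_mul _), integral_const_mul, integral_const_mul,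
    fourierIntegral_gaussian hb'] at h0
  have hbne : (b : ℂ) ≠ 0 := Complex.ofReal_ne_zero.2 hb.ne'
  rw [div_mul_eq_mul_div, eq_div_iff (by simpa using hbne)]
  linear_combination -h0

theorem integral_limit_oscIntegrand {t : ℝ} (ht : 0 < t) (u : ℝ) :
    (((2 * Real.pi)⁻¹ : ℝ) : ℂ) * ∫ θ : ℝ, ((Real.exp (-(t / 2) * θ ^ 2) : ℝ) : ℂ) *
        Complex.exp (Complex.I * (θ : ℂ) * (u : ℂ)) * (-4 * Complex.I * (θ : ℂ)) =
      ((2 * Real.sqrt (2 / Real.pi) * u * Real.exp (-u ^ 2 / (2 * t)) /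
          t ^ (3 / 2 : ℝ) : ℝ) : ℂ) := by
  have hint : ∫ θ : ℝ, ((Real.exp (-(t / 2) * θ ^ 2) : ℝ) : ℂ) *
        Complex.exp (Complex.I * (θ : ℂ) * (u : ℂ)) * (-4 * Complex.I * (θ : ℂ)) =
      -4 * Complex.I * ∫ x : ℝ, (x : ℂ) *
        (Complex.exp (Complex.I * u * x) * Complex.exp (-(t / 2 : ℝ) * (x : ℂ) ^ 2)) := by
    rw [← integral_const_mul]
    congr 1 with θ
    rw [show Complex.I * (θ : ℂ) * u = Complex.I * u * θ by ring]
    push_cast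
    ring
  have hpow : (Real.pi / (t / 2 : ℝ) : ℂ) ^ (1 / 2 : ℂ) =
      ((Real.sqrt (Real.pi / (t / 2)) : ℝ) : ℂ) := by
    rw [Real.sqrt_eq_rpow, Complex.ofReal_cpow (by positivity)]
    push_cast
    rfl
  have hexp : Complex.exp (-(u : ℂ) ^ 2 / (4 * (t / 2 : ℝ))) =
      ((Real.exp (-u ^ 2 / (2 * t)) : ℝ) : ℂ) := by
    push_cast
    congr 2
    ring
  have hsqrt : Real.sqrt (Real.pi / (t / 2)) * t ^ (3 / 2 : ℝ) =
      Real.pi * Real.sqrt (2 / Real.pi) * t := by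
    rw [show (3 / 2 : ℝ) = 1 + 1 / 2 by norm_num, Real.rpow_add ht, Real.rpow_one,
      ← Real.sqrt_eq_rpow, show Real.pi / (t / 2) = Real.pi ^ 2 * (2 / Real.pi) / t by field_simp,
      Real.sqrt_div' _ ht.le, Real.sqrt_mul (by positivity), Real.sqrt_sq Real.pi_pos.le]
    field_simp
  have hreal : (2 * Real.pi)⁻¹ * (4 * (u / (2 * (t / 2)) *
      (Real.sqrt (Real.pi / (t / 2)) * Real.exp (-u ^ 2 / (2 * t))))) =
      2 * Real.sqrt (2 / Real.pi) * u * Real.exp (-u ^ 2 / (2 * t)) / t ^ (3 / 2 : ℝ) := by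
    have hr : 0 < t ^ (3 / 2 : ℝ) := by positivity
    rw [eq_div_iff hr.ne']
    calc _ = 4 * u / (2 * Real.pi * t) * Real.exp (-u ^ 2 / (2 * t)) *
          (Real.sqrt (Real.pi / (t / 2)) * t ^ (3 / 2 : ℝ)) := by field_simp
      _ = _ := by
        rw [hsqrt]
        field_simp
        ring
  rw [hint, integral_mul_exp_mul_exp_neg_mul_sq (half_pos ht), hpow, hexp, ← hreal]
  push_cast
  linear_combination (-(2 * (Real.pi : ℂ))⁻¹ * (4 * (u / (2 * (t / 2)) *
      (Real.sqrt (Real.pi / (t / 2)) * Complex.exp (-u ^ 2 / (2 * t)))))) * Complex.I_sq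

theorem stmt6 (t u : ℝ) (ht : 0 < t) (hu : 0 ≤ u) :
    Tendsto (fun ε : ℝ =>
        (((2 * Real.pi)⁻¹ : ℝ) : ℂ) *
          ∫ θ in Set.Ioo (-(Real.pi / ε ^ 2)) (Real.pi / ε ^ 2),
            ((Real.exp ((Real.cos (ε ^ 2 * θ) - 1) * t / ε ^ 4) : ℝ) : ℂ) *
              Complex.exp (Complex.I * (θ : ℂ) * (u : ℂ)) * Feps ε θ)
      (nhdsWithin 0 (Set.Ioi (0 : ℝ)))
      (nhds ((2 * Real.sqrt (2 / Real.pi) * u * Real.exp (-u ^ 2 / (2 * t)) /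
          t ^ (3 / 2 : ℝ) : ℝ) : ℂ)) := by
  have hmain : Tendsto (fun ε : ℝ => ∫ θ, (Set.Ioo (-(Real.pi / ε ^ 2))
      (Real.pi / ε ^ 2)).indicator (oscIntegrand t u ε) θ) (nhdsWithin 0 (Set.Ioi 0))
      (nhds (∫ θ : ℝ, ((Real.exp (-(t / 2) * θ ^ 2) : ℝ) : ℂ) *
        Complex.exp (Complex.I * (θ : ℂ) * (u : ℂ)) * (-4 * Complex.I * (θ : ℂ)))) := by
    refine tendsto_integral_filter_of_dominated_convergence
      (fun θ => 32 * (|θ| * Real.exp (-(2 / Real.pi ^ 2 * t) * θ ^ 2))) ?_ ?_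
      ((integrable_abs_mul_exp_neg_mul_sq (by positivity)).const_mul 32) ?_
    · refine .of_forall fun ε => (Measurable.aestronglyMeasurable ?_).indicator measurableSet_Ioo
      unfold oscIntegrand Feps
      fun_prop
    · filter_upwards [Ioc_mem_nhdsGT (zero_lt_one' ℝ)] with ε hε
      refine .of_forall fun θ => ?_
      by_cases hθ : θ ∈ Set.Ioo (-(Real.pi / ε ^ 2)) (Real.pi / ε ^ 2)
      · rw [Set.indicator_of_mem hθ]
        exact norm_oscIntegrand_le ht u hε.1 hε.2 hθ
      · rw [Set.indicator_of_notMem hθ, norm_zero]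
        positivity
    · refine .of_forall fun θ => (tendsto_oscIntegrand t u θ).congr' ?_
      have hinf : Tendsto (fun ε : ℝ => Real.pi / ε ^ 2) (nhdsWithin 0 (Set.Ioi 0)) atTop :=
        (tendsto_inv_nhdsGT_zero.comp tendsto_sq_nhdsGT_zero).const_mul_atTop Real.pi_pos
      filter_upwards [hinf.eventually_gt_atTop |θ|] with ε hε
      exact (Set.indicator_of_mem (Set.mem_Ioo.2 (abs_lt.1 hε)) _).symm
  rw [← integral_limit_oscIntegrand ht u]
  refine (hmain.const_mul _).congr fun ε => ?_
  rw [integral_indicator measurableSet_Ioo]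
  rfl
end

section
/- Fix μ ∈ (0,1). For all x, x′ ∈ ℕ, the sum over y ∈ ℕ of the integrals ∫₀^∞ ( p_t^μ(x+1,y) − p_t^μ(x,y) ) ( p_t^μ(x′+1,y) − p_t^μ(x′,y) ) dt converges and equals 1 if x = x′ and 0 otherwise. -/
open MeasureTheory Real

/-- One-step substochastic kernel of the random walk on ℕ reflected/killed at 0,
with staying probability `μ/2` at the origin. -/
noncomputable def qker (μ : ℝ) (x y : ℕ) : ℝ :=
  if x = 0 then (if y = 1 then 1 / 2 else if y = 0 then μ / 2 else 0)
  else (if y = x + 1 ∨ y = x - 1 then 1 / 2 else 0)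

/-- `n`-step kernels. -/
noncomputable def pn (μ : ℝ) : ℕ → ℕ → ℕ → ℝ
  | 0 => fun x y => if x = y then 1 else 0
  | n + 1 => fun x y => ∑' z : ℕ, pn μ n x z * qker μ z y

/-- Continuous-time kernel `p_t^μ(x,y) = Σ_n e^{-t} tⁿ/n! pₙ^μ(x,y)`. -/
noncomputable def pt (μ : ℝ) (t : ℝ) (x y : ℕ) : ℝ :=
  ∑' n : ℕ, Real.exp (-t) * t ^ n / (Nat.factorial n) * pn μ n x y

open Filter Topology
open scoped BoundedContinuousFunction

namespace ReflectedWalk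

/-- The one-step operator of the walk acting on functions on `ℕ`. -/
noncomputable def stepFun (μ : ℝ) (w : ℕ → ℝ) : ℕ → ℝ
  | 0 => w 1 / 2 + μ / 2 * w 0
  | n + 1 => (w n + w (n + 2)) / 2

lemma abs_stepFun_le {μ C D : ℝ} (hμ : |μ| ≤ D) (hD : 1 ≤ D) {w : ℕ → ℝ} (hw : ∀ n, |w n| ≤ C)
    (n : ℕ) : |stepFun μ w n| ≤ D * C := by
  have hC : 0 ≤ C := (abs_nonneg _).trans (hw 0)
  cases n with
  | zero =>
    calc |w 1 / 2 + μ / 2 * w 0| ≤ |w 1 / 2| + |μ / 2 * w 0| := abs_add_le _ _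
      _ = |w 1| / 2 + |μ| * |w 0| / 2 := by
        rw [abs_mul, abs_div, abs_div, abs_two]; ring
      _ ≤ D * C / 2 + D * C / 2 := by
        gcongr
        · exact (hw 1).trans (le_mul_of_one_le_left hC hD)
        · exact hw 0
      _ = D * C := by ring
  | succ n =>
    calc |(w n + w (n + 2)) / 2| = |w n + w (n + 2)| / 2 := by rw [abs_div, abs_two]
      _ ≤ (|w n| + |w (n + 2)|) / 2 := by gcongr; exact abs_add_le _ _
      _ ≤ (D * C + D * C) / 2 := by
        gcongr
        · exact (hw n).trans (le_mul_of_one_le_left hC hD)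
        · exact (hw _).trans (le_mul_of_one_le_left hC hD)
      _ = D * C := by ring

/-- The one-step operator on bounded functions. -/
noncomputable def step (μ : ℝ) : (ℕ →ᵇ ℝ) →L[ℝ] (ℕ →ᵇ ℝ) :=
  LinearMap.mkContinuous
    { toFun := fun w => BoundedContinuousFunction.ofNormedAddCommGroupDiscrete (stepFun μ w)
        ((1 + |μ|) * ‖w‖) (abs_stepFun_le (by linarith) (by linarith [abs_nonneg μ])
          fun n => w.norm_coe_le_norm n)
      map_add' := fun v w => by
        ext n
        cases n <;> simp [stepFun] <;> ring
      map_smul' := fun c w => by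
        ext n
        cases n <;> simp [stepFun] <;> ring }
    (1 + |μ|) fun w => (BoundedContinuousFunction.norm_le (by positivity)).2
      (abs_stepFun_le (by linarith) (by linarith [abs_nonneg μ]) fun n => w.norm_coe_le_norm n)

lemma step_apply_zero (μ : ℝ) (w : ℕ →ᵇ ℝ) : step μ w 0 = w 1 / 2 + μ / 2 * w 0 := rfl

lemma step_apply_succ (μ : ℝ) (w : ℕ →ᵇ ℝ) (n : ℕ) :
    step μ w (n + 1) = (w n + w (n + 2)) / 2 := rfl

lemma norm_step_le {μ : ℝ} (hμ : |μ| ≤ 1) (w : ℕ →ᵇ ℝ) : ‖step μ w‖ ≤ ‖w‖ :=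
  (BoundedContinuousFunction.norm_le (norm_nonneg _)).2 fun n =>
    (abs_stepFun_le hμ le_rfl (fun n => w.norm_coe_le_norm n) n).trans_eq (one_mul _)

lemma norm_step_pow_le {μ : ℝ} (hμ : |μ| ≤ 1) (n : ℕ) (w : ℕ →ᵇ ℝ) :
    ‖(step μ ^ n) w‖ ≤ ‖w‖ := by
  induction n with
  | zero => simp
  | succ n ih =>
    rw [pow_succ']
    exact (norm_step_le hμ _).trans ih

lemma step_mono {μ : ℝ} (hμ : 0 ≤ μ) {v w : ℕ →ᵇ ℝ} (h : ∀ x, v x ≤ w x) (x : ℕ) :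
    step μ v x ≤ step μ w x := by
  cases x with
  | zero => simp only [step_apply_zero]; have := h 0; have := h 1; gcongr
  | succ n => simp only [step_apply_succ]; have := h n; have := h (n + 2); gcongr

lemma step_pow_mono {μ : ℝ} (hμ : 0 ≤ μ) {v w : ℕ →ᵇ ℝ} (h : ∀ x, v x ≤ w x) (n x : ℕ) :
    (step μ ^ n) v x ≤ (step μ ^ n) w x := by
  induction n generalizing x with
  | zero => simpa using h x
  | succ n ih =>
    rw [pow_succ']
    exact step_mono hμ ih x

lemma tendsto_step_pow {ι : Type*} {l : Filter ι} (μ : ℝ) {v : ι → ℕ →ᵇ ℝ} {w : ℕ →ᵇ ℝ}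
    (h : ∀ x, Tendsto (fun i => v i x) l (𝓝 (w x))) (n x : ℕ) :
    Tendsto (fun i => (step μ ^ n) (v i) x) l (𝓝 ((step μ ^ n) w x)) := by
  induction n generalizing x with
  | zero => simpa using h x
  | succ n ih =>
    rw [pow_succ']
    cases x with
    | zero => exact ((ih 1).div_const 2).add ((ih 0).const_mul _)
    | succ m => exact ((ih m).add (ih (m + 2))).div_const 2

/-- The indicator function of a set of natural numbers. -/
noncomputable def ind (s : Set ℕ) : ℕ →ᵇ ℝ :=
  BoundedContinuousFunction.ofNormedAddCommGroupDiscrete (s.indicator 1) 1 fun x => by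
    by_cases hx : x ∈ s <;> simp [hx]

open Classical in
lemma ind_apply (s : Set ℕ) (x : ℕ) : ind s x = if x ∈ s then 1 else 0 := by
  simp [ind, Set.indicator_apply]

lemma ind_nonneg (s : Set ℕ) (x : ℕ) : 0 ≤ ind s x := by
  rw [ind_apply]; split_ifs <;> norm_num

lemma ind_le_ind_univ (s : Set ℕ) (x : ℕ) : ind s x ≤ ind Set.univ x := by
  simp only [ind_apply, Set.mem_univ, if_true]; split_ifs <;> norm_num

lemma norm_ind_le (s : Set ℕ) : ‖ind s‖ ≤ 1 := by
  refine (BoundedContinuousFunction.norm_le zero_le_one).2 fun x => ?_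
  rw [ind_apply]; split_ifs <;> simp

section OperatorExponential

variable {E : Type*} [NormedAddCommGroup E] [NormedSpace ℝ E]

/-- The semigroup generated by `A - 1`. -/
noncomputable def expSemi (A : E →L[ℝ] E) (t : ℝ) : E →L[ℝ] E :=
  Real.exp (-t) • NormedSpace.exp (t • A)

lemma expSemi_zero (A : E →L[ℝ] E) : expSemi A 0 = 1 := by simp [expSemi]

variable [CompleteSpace E]

lemma expSemi_add (A : E →L[ℝ] E) (s t : ℝ) :
    expSemi A (s + t) = expSemi A s * expSemi A t := by
  let : NormedAlgebra ℚ (E →L[ℝ] E) := NormedAlgebra.restrictScalars ℚ ℝ _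
  rw [expSemi, expSemi, expSemi, add_smul, NormedSpace.exp_add_of_commute
    (((Commute.refl A).smul_left s).smul_right t), neg_add, Real.exp_add,
    smul_mul_smul_comm]

lemma hasDerivAt_expSemi (A : E →L[ℝ] E) (t : ℝ) :
    HasDerivAt (expSemi A) (expSemi A t * (A - 1)) t := by
  have h1 := hasDerivAt_exp_smul_const A t
  have h2 : HasDerivAt (fun t : ℝ => Real.exp (-t)) (-Real.exp (-t)) t := by
    simpa using (hasDerivAt_neg t).exp
  refine (h2.smul h1).congr_deriv ?_
  rw [expSemi, mul_sub, mul_one, smul_mul_assoc, neg_smul, sub_eq_add_neg]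

lemma hasDerivAt_expSemi_apply (A : E →L[ℝ] E) (t : ℝ) (w : E) (φ : E →L[ℝ] ℝ) :
    HasDerivAt (fun t => φ (expSemi A t w)) (φ (expSemi A t (A w - w))) t :=
  (φ.comp (ContinuousLinearMap.apply ℝ E w)).hasFDerivAt.comp_hasDerivAt t
    (hasDerivAt_expSemi A t)

lemma hasSum_expSemi_apply (A : E →L[ℝ] E) (t : ℝ) (w : E) (φ : E →L[ℝ] ℝ) :
    HasSum (fun n : ℕ => Real.exp (-t) * t ^ n / n.factorial * φ ((A ^ n) w))
      (φ (expSemi A t w)) := by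
  have h := (NormedSpace.exp_series_hasSum_exp' (𝕂 := ℝ) (t • A)).mapL
    (φ.comp (ContinuousLinearMap.apply ℝ E w))
  have e : φ (expSemi A t w) = Real.exp (-t) *
      (φ.comp (ContinuousLinearMap.apply ℝ E w)) (NormedSpace.exp (t • A)) :=
    φ.map_smul (Real.exp (-t)) (NormedSpace.exp (t • A) w)
  rw [e]
  refine (congrArg (HasSum · _) (funext fun n => ?_)).mp (h.mul_left (Real.exp (-t)))
  have e' : (φ.comp (ContinuousLinearMap.apply ℝ E w)) ((n.factorial : ℝ)⁻¹ • (t • A) ^ n) =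
      (n.factorial : ℝ)⁻¹ * (t ^ n * φ ((A ^ n) w)) := by
    rw [smul_pow, map_smul, map_smul]
    rfl
  rw [e']
  ring

end OperatorExponential

/-- The semigroup generated by `step μ - 1`. -/
noncomputable def semi (μ t : ℝ) : (ℕ →ᵇ ℝ) →L[ℝ] (ℕ →ᵇ ℝ) := expSemi (step μ) t

lemma semi_zero_apply (μ : ℝ) (w : ℕ →ᵇ ℝ) : semi μ 0 w = w := by
  rw [semi, expSemi_zero]; rfl

lemma semi_add_apply (μ s t : ℝ) (w : ℕ →ᵇ ℝ) :
    semi μ (s + t) w = semi μ s (semi μ t w) := by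
  rw [semi, expSemi_add]; rfl

lemma hasDerivAt_semi_apply (μ t : ℝ) (w : ℕ →ᵇ ℝ) (x : ℕ) :
    HasDerivAt (fun t => semi μ t w x) (semi μ t (step μ w - w) x) t :=
  hasDerivAt_expSemi_apply (step μ) t w (BoundedContinuousFunction.evalCLM ℝ x)

lemma continuous_semi_apply (μ : ℝ) (w : ℕ →ᵇ ℝ) (x : ℕ) :
    Continuous (fun t => semi μ t w x) :=
  continuous_iff_continuousAt.2 fun t => (hasDerivAt_semi_apply μ t w x).continuousAt

lemma hasSum_semi_apply (μ t : ℝ) (w : ℕ →ᵇ ℝ) (x : ℕ) :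
    HasSum (fun n : ℕ => Real.exp (-t) * t ^ n / n.factorial * (step μ ^ n) w x)
      (semi μ t w x) :=
  hasSum_expSemi_apply (step μ) t w (BoundedContinuousFunction.evalCLM ℝ x)

lemma summable_poisson (t : ℝ) :
    Summable (fun n : ℕ => Real.exp (-t) * t ^ n / n.factorial) := by
  simpa only [mul_div_assoc] using (Real.summable_pow_div_factorial t).mul_left (Real.exp (-t))

lemma tsum_poisson (t : ℝ) : ∑' n : ℕ, Real.exp (-t) * t ^ n / n.factorial = 1 := by
  simp only [mul_div_assoc]
  rw [tsum_mul_left, ← congrFun NormedSpace.exp_eq_tsum_div t, ← congrFun Real.exp_eq_exp_ℝ,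
    ← Real.exp_add]
  simp

lemma tendsto_semi_apply {ι : Type*} {l : Filter ι} {μ t C : ℝ} (hμ : |μ| ≤ 1) (ht : 0 ≤ t)
    {v : ι → ℕ →ᵇ ℝ} {w : ℕ →ᵇ ℝ} (hv : ∀ i, ‖v i‖ ≤ C)
    (h : ∀ x, Tendsto (fun i => v i x) l (𝓝 (w x))) (x : ℕ) :
    Tendsto (fun i => semi μ t (v i) x) l (𝓝 (semi μ t w x)) := by
  simp only [← (hasSum_semi_apply μ t _ x).tsum_eq]
  refine tendsto_tsum_of_dominated_convergence ((summable_poisson t).mul_right C)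
    (fun n => (tendsto_step_pow μ h n x).const_mul _) (Eventually.of_forall fun i n => ?_)
  rw [norm_mul, Real.norm_of_nonneg (by positivity)]
  gcongr
  exact (BoundedContinuousFunction.norm_coe_le_norm _ x).trans
    ((norm_step_pow_le hμ n _).trans (hv i))

lemma hasSum_semi_kernel {μ t : ℝ} (hμ : |μ| ≤ 1) (ht : 0 ≤ t) (w : ℕ →ᵇ ℝ) (x : ℕ) :
    HasSum (fun y => semi μ t (ind {y}) x * w y) (semi μ t w x) := by
  have key : ∀ (s : Finset ℕ) (x : ℕ),
      (∑ y ∈ s, w y • ind {y}) x = if x ∈ s then w x else 0 := by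
    intro s x
    simp [ind_apply]
  have h := tendsto_semi_apply (l := atTop) (v := fun s : Finset ℕ => ∑ y ∈ s, w y • ind {y})
    (w := w) (C := ‖w‖) hμ ht
    (fun s => (BoundedContinuousFunction.norm_le (norm_nonneg _)).2 fun x => by
      rw [key]
      split_ifs
      · exact w.norm_coe_le_norm x
      · simp)
    (fun x => by
      refine tendsto_const_nhds.congr' ?_
      filter_upwards [eventually_ge_atTop {x}] with s hs
      rw [key, if_pos (hs (Finset.mem_singleton_self x))]) x
  refine h.congr fun s => ?_
  simp [mul_comm]

lemma qker_comm (μ : ℝ) (x y : ℕ) : qker μ x y = qker μ y x := by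
  unfold qker
  split_ifs <;> first | rfl | omega

lemma step_ind_apply (μ : ℝ) (x y : ℕ) : step μ (ind {y}) x = qker μ x y := by
  cases x with
  | zero =>
    simp only [step_apply_zero, ind_apply, Set.mem_singleton_iff, qker]
    split_ifs <;> first | omega | ring
  | succ n =>
    simp only [step_apply_succ, ind_apply, Set.mem_singleton_iff, qker, Nat.succ_ne_zero, if_false]
    split_ifs <;> first | omega | norm_num

lemma step_apply_eq_tsum (μ : ℝ) (w : ℕ →ᵇ ℝ) (x : ℕ) :
    step μ w x = ∑' z, qker μ x z * w z := by
  cases x with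
  | zero =>
    rw [tsum_eq_sum (s := {0, 1}) (fun z hz => by
      simp only [Finset.mem_insert, Finset.mem_singleton, not_or] at hz
      simp [qker, hz]), Finset.sum_pair zero_ne_one]
    simp [qker, step_apply_zero]
    ring
  | succ n =>
    rw [tsum_eq_sum (s := {n, n + 2}) (fun z hz => by
      simp only [Finset.mem_insert, Finset.mem_singleton, not_or] at hz
      simp [qker, hz]), Finset.sum_pair (by omega)]
    simp [qker, step_apply_succ]
    ring

lemma step_ind_eq_sum (μ : ℝ) (y : ℕ) :
    step μ (ind {y}) = ∑ z ∈ Finset.range (y + 2), qker μ z y • ind {z} := by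
  ext x
  rw [step_ind_apply]
  simp only [BoundedContinuousFunction.coe_sum, Finset.sum_apply,
    BoundedContinuousFunction.coe_smul, ind_apply, Set.mem_singleton_iff, smul_eq_mul, mul_ite,
    mul_one, mul_zero, Finset.sum_ite_eq, Finset.mem_range]
  split_ifs with h
  · rfl
  · unfold qker
    split_ifs <;> first | rfl | omega

lemma pn_eq_step_pow (μ : ℝ) (n x y : ℕ) : pn μ n x y = (step μ ^ n) (ind {y}) x := by
  induction n generalizing y with
  | zero => simp [pn, ind_apply]
  | succ n ih =>
    rw [pow_succ, mul_apply_eq_comp, step_ind_eq_sum]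
    simp only [pn, ih]
    rw [tsum_eq_sum (s := Finset.range (y + 2)) fun z hz => ?_]
    · simp [mul_comm]
    · rw [Finset.mem_range] at hz
      have : qker μ z y = 0 := by
        unfold qker
        split_ifs <;> first | rfl | omega
      rw [this, mul_zero]

lemma pn_comm (μ : ℝ) (n x y : ℕ) : pn μ n x y = pn μ n y x := by
  induction n generalizing x y with
  | zero => simp [pn, eq_comm]
  | succ n ih =>
    rw [pn_eq_step_pow μ (n + 1) y x, pow_succ', mul_apply_eq_comp,
      step_apply_eq_tsum]
    simp only [pn, ← pn_eq_step_pow]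
    refine tsum_congr fun z => ?_
    rw [ih x z, qker_comm μ z y, mul_comm]

lemma pt_eq_semi (μ t : ℝ) (x y : ℕ) : pt μ t x y = semi μ t (ind {y}) x := by
  rw [pt, ← (hasSum_semi_apply μ t _ x).tsum_eq]
  simp only [pn_eq_step_pow]

lemma pt_comm (μ t : ℝ) (x y : ℕ) : pt μ t x y = pt μ t y x := by
  simp only [pt, pn_comm μ _ x y]

/-- The discrete gradient of the Dirac mass. -/
noncomputable def dip (x : ℕ) : ℕ →ᵇ ℝ := ind {x + 1} - ind {x}

lemma pt_sub_pt (μ t : ℝ) (x y : ℕ) :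
    pt μ t (x + 1) y - pt μ t x y = semi μ t (dip x) y := by
  rw [pt_comm μ t (x + 1), pt_comm μ t x, pt_eq_semi, pt_eq_semi, dip, map_sub]
  rfl

lemma hasSum_mul_gradient {μ t : ℝ} (hμ : |μ| ≤ 1) (ht : 0 ≤ t) (x x' : ℕ) :
    HasSum (fun y => (pt μ t (x + 1) y - pt μ t x y) * (pt μ t (x' + 1) y - pt μ t x' y))
      (semi μ (2 * t) (dip x') (x + 1) - semi μ (2 * t) (dip x') x) := by
  rw [two_mul, semi_add_apply]
  simp only [pt_sub_pt μ t x']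
  simp only [sub_mul, pt_eq_semi]
  exact (hasSum_semi_kernel hμ ht _ _).sub (hasSum_semi_kernel hμ ht _ _)

lemma step_ind_Ioi_sub (μ : ℝ) (x : ℕ) :
    step μ (ind (Set.Ioi x)) - ind (Set.Ioi x) = (-(1 / 2) : ℝ) • dip x := by
  ext y
  cases y with
  | zero =>
    simp only [BoundedContinuousFunction.coe_sub, Pi.sub_apply,
      BoundedContinuousFunction.coe_smul, smul_eq_mul, dip, step_apply_zero, ind_apply,
      Set.mem_singleton_iff, Set.mem_Ioi]
    split_ifs <;> first | omega | (exfalso; omega) | norm_num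
  | succ n =>
    simp only [BoundedContinuousFunction.coe_sub, Pi.sub_apply,
      BoundedContinuousFunction.coe_smul, smul_eq_mul, dip, step_apply_succ, ind_apply,
      Set.mem_singleton_iff, Set.mem_Ioi]
    split_ifs <;> first | omega | norm_num

lemma eq_zero_of_harmonic_of_le {μ C : ℝ} (hμ : μ < 1) {f : ℕ → ℝ} (h0 : ∀ x, 0 ≤ f x)
    (hC : ∀ x, f x ≤ C) (hf : stepFun μ f = f) (x : ℕ) : f x = 0 := by
  have hlin : ∀ x : ℕ, f x = f 0 * (1 + (1 - μ) * x) ∧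
      f (x + 1) = f 0 * (1 + (1 - μ) * (x + 1)) := by
    intro x
    induction x with
    | zero =>
      have h := congrFun hf 0
      simp only [stepFun] at h
      constructor
      · simp
      · simp only [zero_add, Nat.cast_zero]
        linarith
    | succ n ih =>
      have h := congrFun hf (n + 1)
      simp only [stepFun] at h
      refine ⟨by push_cast; exact ih.2, ?_⟩
      push_cast
      have h1 := ih.1
      have h2 := ih.2
      change f (n + 2) = _
      linarith
  have hz : f 0 = 0 := by
    by_contra hne
    have hpos : 0 < f 0 * (1 - μ) :=
      mul_pos (lt_of_le_of_ne (h0 0) (Ne.symm hne)) (by linarith)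
    obtain ⟨n, hn⟩ := exists_nat_gt (C / (f 0 * (1 - μ)))
    rw [div_lt_iff₀ hpos] at hn
    have h1 := (hlin n).1
    have h2 := hC n
    have h3 := h0 0
    nlinarith
  rw [(hlin x).1, hz, zero_mul]

lemma step_pow_ind_nonneg {μ : ℝ} (hμ : 0 ≤ μ) (s : Set ℕ) (n x : ℕ) :
    0 ≤ (step μ ^ n) (ind s) x := by
  simpa using step_pow_mono hμ (v := 0) (w := ind s) (ind_nonneg s) n x

lemma tendsto_step_pow_ind {μ : ℝ} (hμ : μ ∈ Set.Ioo (0 : ℝ) 1) (s : Set ℕ) (x : ℕ) :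
    Tendsto (fun n => (step μ ^ n) (ind s) x) atTop (𝓝 0) := by
  have habs : |μ| ≤ 1 := abs_le.2 ⟨by linarith [hμ.1], hμ.2.le⟩
  have hle : ∀ n x, (step μ ^ n) (ind Set.univ) x ≤ 1 := fun n x =>
    (le_abs_self _).trans ((BoundedContinuousFunction.norm_coe_le_norm _ x).trans
      ((norm_step_pow_le habs n _).trans (norm_ind_le _)))
  have hanti : ∀ x, Antitone fun n => (step μ ^ n) (ind Set.univ) x := by
    refine fun x => antitone_nat_of_succ_le fun n => ?_
    rw [pow_succ, mul_apply_eq_comp]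
    refine step_pow_mono hμ.1.le (fun x => ?_) n x
    simpa [ind_apply] using hle 1 x
  have hlim : ∀ x, ∃ L, Tendsto (fun n => (step μ ^ n) (ind Set.univ) x) atTop (𝓝 L) := fun x =>
    ⟨_, tendsto_atTop_ciInf (hanti x)
      ⟨0, by rintro _ ⟨n, rfl⟩; exact step_pow_ind_nonneg hμ.1.le _ n x⟩⟩
  choose L hL using hlim
  have hharm : stepFun μ L = L := by
    funext x
    refine tendsto_nhds_unique (f := fun n => (step μ ^ (n + 1)) (ind Set.univ) x) ?_
      ((hL x).comp (tendsto_add_atTop_nat 1))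
    simp only [pow_succ', mul_apply_eq_comp]
    cases x with
    | zero => exact ((hL 1).div_const 2).add ((hL 0).const_mul _)
    | succ m => exact ((hL m).add (hL (m + 2))).div_const 2
  have hzero := eq_zero_of_harmonic_of_le hμ.2
    (fun x => ge_of_tendsto' (hL x) fun n => step_pow_ind_nonneg hμ.1.le _ n x)
    (fun x => le_of_tendsto' (hL x) fun n => hle n x) hharm x
  exact squeeze_zero (fun n => step_pow_ind_nonneg hμ.1.le _ n x)
    (fun n => step_pow_mono hμ.1.le (ind_le_ind_univ s) n x) (hzero ▸ hL x)

lemma tendsto_poisson_weight (n : ℕ) :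
    Tendsto (fun t : ℝ => Real.exp (-t) * t ^ n / n.factorial) atTop (𝓝 0) := by
  simpa [mul_comm] using
    (Real.tendsto_pow_mul_exp_neg_atTop_nhds_zero n).div_const (n.factorial : ℝ)

/-- Poisson averages of a null sequence tend to zero as the intensity grows. -/
lemma tendsto_tsum_poisson_mul {b : ℕ → ℝ} (hb : Tendsto b atTop (𝓝 0)) :
    Tendsto (fun t : ℝ => ∑' n : ℕ, Real.exp (-t) * t ^ n / n.factorial * b n) atTop (𝓝 0) := by
  rw [Metric.tendsto_nhds]
  intro ε hε
  obtain ⟨N, hN⟩ := eventually_atTop.1 (Metric.tendsto_nhds.1 hb (ε / 2) (half_pos hε))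
  have hhead : Tendsto (fun t : ℝ => ∑ n ∈ Finset.range N,
      Real.exp (-t) * t ^ n / n.factorial * |b n|) atTop (𝓝 0) := by
    simpa using tendsto_finsetSum (Finset.range N)
      fun n _ => (tendsto_poisson_weight n).mul_const |b n|
  filter_upwards [hhead.eventually_lt_const (half_pos hε), eventually_ge_atTop 0] with t ht h0
  set p : ℕ → ℝ := fun n => Real.exp (-t) * t ^ n / n.factorial with hp
  have hp0 : ∀ n, 0 ≤ p n := fun n => by positivity
  have hsum : HasSum (fun n => (if n ∈ Finset.range N then p n * |b n| else 0) + p n * (ε / 2))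
      (∑ n ∈ Finset.range N, p n * |b n| + 1 * (ε / 2)) := by
    refine HasSum.add ?_ ((tsum_poisson t ▸ (summable_poisson t).hasSum).mul_right _)
    have h := hasSum_sum_of_ne_finset_zero (L := .unconditional ℕ) (s := Finset.range N)
      (f := fun n => if n ∈ Finset.range N then p n * |b n| else 0) fun n hn => if_neg hn
    rwa [Finset.sum_congr rfl fun n hn => if_pos hn] at h
  have hbound : ‖∑' n, p n * b n‖ ≤ ∑ n ∈ Finset.range N, p n * |b n| + 1 * (ε / 2) := by
    refine tsum_of_norm_bounded hsum fun n => ?_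
    rw [norm_mul, Real.norm_of_nonneg (hp0 n), Real.norm_eq_abs]
    split_ifs with hn
    · have := mul_nonneg (hp0 n) (half_pos hε).le
      linarith
    · rw [zero_add]
      have := hN n (by simpa using hn)
      rw [Real.dist_eq, sub_zero] at this
      exact mul_le_mul_of_nonneg_left this.le (hp0 n)
  rw [dist_zero_right]
  linarith

lemma tendsto_semi_ind {μ : ℝ} (hμ : μ ∈ Set.Ioo (0 : ℝ) 1) (s : Set ℕ) (x : ℕ) :
    Tendsto (fun t => semi μ t (ind s) x) atTop (𝓝 0) := by
  simp only [← (hasSum_semi_apply μ _ _ x).tsum_eq]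
  exact tendsto_tsum_poisson_mul (tendsto_step_pow_ind hμ s x)

/-- A primitive in `t` of the sum over `y` of the products of gradients of `pt`. -/
noncomputable def energyPrimitive (μ : ℝ) (x x' : ℕ) (t : ℝ) : ℝ :=
  semi μ (2 * t) (ind (Set.Ioi x')) x - semi μ (2 * t) (ind (Set.Ioi x')) (x + 1)

lemma hasDerivAt_energyPrimitive (μ : ℝ) (x x' : ℕ) (t : ℝ) :
    HasDerivAt (energyPrimitive μ x x')
      (semi μ (2 * t) (dip x') (x + 1) - semi μ (2 * t) (dip x') x) t := by
  have h2 : HasDerivAt (fun t : ℝ => 2 * t) 2 t := by simpa using (hasDerivAt_id t).const_mul 2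
  have h : ∀ z, HasDerivAt (fun t => semi μ (2 * t) (ind (Set.Ioi x')) z)
      (-semi μ (2 * t) (dip x') z) t := fun z => by
    refine ((hasDerivAt_semi_apply μ (2 * t) (ind (Set.Ioi x')) z).comp t h2).congr_deriv ?_
    rw [step_ind_Ioi_sub, map_smul, BoundedContinuousFunction.smul_apply, smul_eq_mul]
    ring
  refine ((h x).sub (h (x + 1))).congr_deriv ?_
  ring

lemma tendsto_energyPrimitive {μ : ℝ} (hμ : μ ∈ Set.Ioo (0 : ℝ) 1) (x x' : ℕ) :
    Tendsto (energyPrimitive μ x x') atTop (𝓝 0) := by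
  have h2 : Tendsto (fun t : ℝ => 2 * t) atTop atTop := tendsto_id.const_mul_atTop two_pos
  have h := ((tendsto_semi_ind hμ (Set.Ioi x') x).comp h2).sub
    ((tendsto_semi_ind hμ (Set.Ioi x') (x + 1)).comp h2)
  rwa [sub_zero] at h

lemma energyPrimitive_zero (μ : ℝ) (x x' : ℕ) :
    energyPrimitive μ x x' 0 = -if x = x' then 1 else 0 := by
  simp only [energyPrimitive, mul_zero, semi_zero_apply, ind_apply, Set.mem_Ioi]
  split_ifs <;> first | omega | norm_num

lemma continuous_gradient (μ : ℝ) (x y : ℕ) :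
    Continuous fun t => pt μ t (x + 1) y - pt μ t x y := by
  simp only [pt_sub_pt]
  exact continuous_semi_apply μ _ y

lemma hasSum_sq_gradient {μ t : ℝ} (hμ : |μ| ≤ 1) (ht : 0 ≤ t) (x : ℕ) :
    HasSum (fun y => (pt μ t (x + 1) y - pt μ t x y) ^ 2)
      (semi μ (2 * t) (dip x) (x + 1) - semi μ (2 * t) (dip x) x) := by
  simpa only [sq] using hasSum_mul_gradient hμ ht x x

lemma norm_mul_le_sq_add_sq (a b : ℝ) : ‖a * b‖ ≤ a ^ 2 + b ^ 2 := by
  rw [Real.norm_eq_abs, abs_le]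
  constructor <;> nlinarith [sq_nonneg (a + b), sq_nonneg (a - b)]

lemma integrableOn_energy_self {μ : ℝ} (hμ : μ ∈ Set.Ioo (0 : ℝ) 1) (x : ℕ) :
    IntegrableOn (fun t => semi μ (2 * t) (dip x) (x + 1) - semi μ (2 * t) (dip x) x)
      (Set.Ioi 0) :=
  integrableOn_Ioi_deriv_of_nonneg
    (hasDerivAt_energyPrimitive μ x x 0).continuousAt.continuousWithinAt
    (fun t _ => hasDerivAt_energyPrimitive μ x x t)
    (fun _ ht => (hasSum_sq_gradient (abs_le.2 ⟨by linarith [hμ.1], hμ.2.le⟩)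
      (le_of_lt ht) x).nonneg fun _ => sq_nonneg _)
    (tendsto_energyPrimitive hμ x x)

lemma integrableOn_energy {μ : ℝ} (hμ : μ ∈ Set.Ioo (0 : ℝ) 1) (x x' : ℕ) :
    IntegrableOn (fun t => semi μ (2 * t) (dip x') (x + 1) - semi μ (2 * t) (dip x') x)
      (Set.Ioi 0) := by
  have habs : |μ| ≤ 1 := abs_le.2 ⟨by linarith [hμ.1], hμ.2.le⟩
  have hc : Continuous fun t : ℝ => 2 * t := continuous_const.mul continuous_id
  refine Integrable.mono' ((integrableOn_energy_self hμ x).add (integrableOn_energy_self hμ x'))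
    (((continuous_semi_apply μ (dip x') (x + 1)).comp hc).sub
      ((continuous_semi_apply μ (dip x') x).comp hc)).aestronglyMeasurable ?_
  filter_upwards [ae_restrict_mem measurableSet_Ioi] with t ht
  have h := (hasSum_sq_gradient habs (le_of_lt ht) x).add
    (hasSum_sq_gradient habs (le_of_lt ht) x')
  rw [← (hasSum_mul_gradient habs (le_of_lt ht) x x').tsum_eq]
  exact tsum_of_norm_bounded h fun y => norm_mul_le_sq_add_sq _ _

lemma integrableOn_sq_gradient {μ : ℝ} (hμ : μ ∈ Set.Ioo (0 : ℝ) 1) (x y : ℕ) :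
    IntegrableOn (fun t => (pt μ t (x + 1) y - pt μ t x y) ^ 2) (Set.Ioi 0) := by
  refine Integrable.mono' (integrableOn_energy_self hμ x)
    ((continuous_gradient μ x y).pow 2).aestronglyMeasurable ?_
  filter_upwards [ae_restrict_mem measurableSet_Ioi] with t ht
  rw [Real.norm_of_nonneg (sq_nonneg _)]
  exact le_hasSum (hasSum_sq_gradient (abs_le.2 ⟨by linarith [hμ.1], hμ.2.le⟩) (le_of_lt ht) x) y
    fun _ _ => sq_nonneg _

lemma summable_integral_sq_gradient {μ : ℝ} (hμ : μ ∈ Set.Ioo (0 : ℝ) 1) (x : ℕ) :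
    Summable fun y => ∫ t in Set.Ioi (0 : ℝ), (pt μ t (x + 1) y - pt μ t x y) ^ 2 := by
  refine summable_of_sum_le
    (c := ∫ t in Set.Ioi (0 : ℝ), (semi μ (2 * t) (dip x) (x + 1) - semi μ (2 * t) (dip x) x))
    (fun y => integral_nonneg fun t => sq_nonneg _) fun s => ?_
  rw [← integral_finsetSum s fun y _ => integrableOn_sq_gradient hμ x y]
  refine setIntegral_mono_on (integrable_finsetSum s fun y _ => integrableOn_sq_gradient hμ x y)
    (integrableOn_energy_self hμ x) measurableSet_Ioi fun t ht => ?_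
  exact sum_le_hasSum s (fun _ _ => sq_nonneg _)
    (hasSum_sq_gradient (abs_le.2 ⟨by linarith [hμ.1], hμ.2.le⟩) (le_of_lt ht) x)

end ReflectedWalk

open ReflectedWalk

theorem stmt10 (μ : ℝ) (hμ : μ ∈ Set.Ioo (0 : ℝ) 1) (x x' : ℕ) :
    (∀ y : ℕ, IntegrableOn
        (fun t : ℝ => (pt μ t (x + 1) y - pt μ t x y) * (pt μ t (x' + 1) y - pt μ t x' y))
        (Set.Ioi 0)) ∧
    Summable (fun y : ℕ =>
        ∫ t in Set.Ioi (0 : ℝ),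
          (pt μ t (x + 1) y - pt μ t x y) * (pt μ t (x' + 1) y - pt μ t x' y)) ∧
    (∑' y : ℕ, ∫ t in Set.Ioi (0 : ℝ),
          (pt μ t (x + 1) y - pt μ t x y) * (pt μ t (x' + 1) y - pt μ t x' y))
      = if x = x' then 1 else 0 := by
  have habs : |μ| ≤ 1 := abs_le.2 ⟨by linarith [hμ.1], hμ.2.le⟩
  have h1 := integrableOn_sq_gradient hμ x
  have h2 := integrableOn_sq_gradient hμ x'
  have hint : ∀ y : ℕ, IntegrableOn
      (fun t : ℝ => (pt μ t (x + 1) y - pt μ t x y) * (pt μ t (x' + 1) y - pt μ t x' y))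
      (Set.Ioi 0) := fun y =>
    Integrable.mono' ((h1 y).add (h2 y))
      ((continuous_gradient μ x y).mul (continuous_gradient μ x' y)).aestronglyMeasurable
      (ae_of_all _ fun t => norm_mul_le_sq_add_sq _ _)
  have hsum : Summable fun y : ℕ => ∫ t in Set.Ioi (0 : ℝ),
      ‖(pt μ t (x + 1) y - pt μ t x y) * (pt μ t (x' + 1) y - pt μ t x' y)‖ := by
    refine Summable.of_nonneg_of_le (fun y => integral_nonneg fun t => norm_nonneg _)
      (fun y => ?_) ((summable_integral_sq_gradient hμ x).add
        (summable_integral_sq_gradient hμ x'))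
    rw [← integral_add (h1 y) (h2 y)]
    exact integral_mono (hint y).norm ((h1 y).add (h2 y)) fun t => norm_mul_le_sq_add_sq _ _
  have hfin := hasSum_integral_of_summable_integral_norm hint hsum
  have hDeq : Set.EqOn (fun t => ∑' y : ℕ,
        (pt μ t (x + 1) y - pt μ t x y) * (pt μ t (x' + 1) y - pt μ t x' y))
      (fun t => semi μ (2 * t) (dip x') (x + 1) - semi μ (2 * t) (dip x') x) (Set.Ioi 0) :=
    fun t ht => (hasSum_mul_gradient habs (le_of_lt ht) x x').tsum_eq
  rw [setIntegral_congr_fun measurableSet_Ioi hDeq, integral_Ioi_of_hasDerivAt_of_tendsto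
    (hasDerivAt_energyPrimitive μ x x' 0).continuousAt.continuousWithinAt
    (fun t _ => hasDerivAt_energyPrimitive μ x x' t) (integrableOn_energy hμ x x')
    (tendsto_energyPrimitive hμ x x'),
    energyPrimitive_zero, zero_sub, neg_neg] at hfin
  exact ⟨hint, hfin.summable, hfin.tsum_eq⟩
end

section
/- Fix μ ∈ (0,1) and define, for t ≥ 0 and integers x ≥ −1, y ≥ 0, F_t(x,y) := p_t(x−y) + μ p_t(x+y+1) + (1−μ^{−2}) Σ_{z≥2} μ^z p_t(x+y+z) (an absolutely convergent series). Then: (i) F_0(x,y) = 1 if x = y and 0 otherwise, for all x, y ∈ ℕ; (ii) for all x, y ∈ ℕ and t ≥ 0, the map t ↦ F_t(x,y) is differentiable and d/dt F_t(x,y) = (1/2)( F_t(x+1,y) + F_t(x−1,y) − 2 F_t(x,y) ); (iii) F_t(−1,y) = μ F_t(0,y) for all t ≥ 0 and y ∈ ℕ. -/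
open MeasureTheory Real

/-- `n`-step transition probability of the simple symmetric random walk on ℤ. -/
noncomputable def rn (n : ℕ) (x : ℤ) : ℝ :=
  if Even ((n : ℤ) + x) ∧ |x| ≤ (n : ℤ) then
    (Nat.choose n (((n : ℤ) + x) / 2).toNat : ℝ) / 2 ^ n
  else 0

/-- Continuous-time simple symmetric random walk kernel on ℤ. -/
noncomputable def pline (t : ℝ) (x : ℤ) : ℝ :=
  ∑' n : ℕ, Real.exp (-t) * t ^ n / (Nat.factorial n) * rn n x

/-- Images-method formula for the Robin heat kernel:
`F_t(x,y) = p_t(x−y) + μ p_t(x+y+1) + (1−μ^{−2}) Σ_{z≥2} μ^z p_t(x+y+z)`. -/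
noncomputable def Fker (μ : ℝ) (t : ℝ) (x : ℤ) (y : ℕ) : ℝ :=
  pline t (x - y) + μ * pline t (x + y + 1) +
    (1 - μ ^ (-2 : ℤ)) * ∑' z : ℕ, μ ^ (z + 2) * pline t (x + y + (z + 2))

/-- The `n`-step kernel at an endpoint written as `2 * k - n`. -/
theorem rn_two_mul_sub (n k : ℕ) : rn n (2 * (k : ℤ) - n) = (n.choose k : ℝ) / 2 ^ n := by
  unfold rn
  have he : (n : ℤ) + (2 * (k : ℤ) - n) = 2 * k := by ring
  rw [he]
  by_cases hk : k ≤ n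
  · rw [if_pos ⟨even_two_mul _, by rw [abs_le]; constructor <;> omega⟩]
    have : (2 * (k : ℤ) / 2).toNat = k := by omega
    rw [this]
  · rw [if_neg, Nat.choose_eq_zero_of_lt (by omega)]
    · simp
    · rintro ⟨-, h⟩
      rw [abs_le] at h
      omega

theorem rn_eq_zero_of_lt_neg {n : ℕ} {x : ℤ} (h : x < -n) : rn n x = 0 := by
  unfold rn
  rw [if_neg]
  rintro ⟨-, h'⟩
  rw [abs_le] at h'
  omega

theorem rn_eq_zero_of_not_even {n : ℕ} {x : ℤ} (h : ¬ Even ((n : ℤ) + x)) : rn n x = 0 := by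
  unfold rn
  rw [if_neg fun h' => h h'.1]

theorem rn_zero (x : ℤ) : rn 0 x = if x = 0 then 1 else 0 := by
  by_cases hx : x = 0
  · simp [rn, hx]
  · simp [rn, hx]

/-- One-step recurrence of the simple random walk. -/
theorem rn_succ (n : ℕ) (x : ℤ) : rn (n + 1) x = (rn n (x + 1) + rn n (x - 1)) / 2 := by
  by_cases he : Even (((n + 1 : ℕ) : ℤ) + x)
  · obtain ⟨k, hk⟩ := he
    push_cast at hk
    rcases lt_trichotomy k 0 with h | h | h
    · rw [rn_eq_zero_of_lt_neg, rn_eq_zero_of_lt_neg, rn_eq_zero_of_lt_neg]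
      · simp
      all_goals push_cast; omega
    · have h1 : x = 2 * ((0 : ℕ) : ℤ) - ((n + 1 : ℕ) : ℤ) := by push_cast; omega
      have h2 : x + 1 = 2 * ((0 : ℕ) : ℤ) - (n : ℤ) := by push_cast; omega
      rw [rn_eq_zero_of_lt_neg (x := x - 1) (by omega), h2, rn_two_mul_sub, h1, rn_two_mul_sub]
      simp [pow_succ]
      ring
    · obtain ⟨j, rfl⟩ : ∃ j : ℕ, k = j + 1 := ⟨(k - 1).toNat, by omega⟩
      have h1 : x = 2 * ((j + 1 : ℕ) : ℤ) - ((n + 1 : ℕ) : ℤ) := by push_cast; omega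
      have h2 : x + 1 = 2 * ((j + 1 : ℕ) : ℤ) - (n : ℤ) := by push_cast; omega
      have h3 : x - 1 = 2 * (j : ℤ) - (n : ℤ) := by omega
      rw [h2, h3, h1, rn_two_mul_sub, rn_two_mul_sub, rn_two_mul_sub, Nat.choose_succ_succ]
      push_cast
      field_simp
      ring
  · have h1 : ¬ Even ((n : ℤ) + (x + 1)) := by
      intro h; apply he; rw [Int.even_iff] at h ⊢; omega
    have h2 : ¬ Even ((n : ℤ) + (x - 1)) := by
      intro h; apply h1; rw [Int.even_iff] at h ⊢; omega
    rw [rn_eq_zero_of_not_even he, rn_eq_zero_of_not_even h1, rn_eq_zero_of_not_even h2]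
    simp

theorem rn_neg (n : ℕ) (x : ℤ) : rn n (-x) = rn n x := by
  induction n generalizing x with
  | zero => simp [rn_zero]
  | succ n ih =>
    rw [rn_succ, rn_succ, ← ih (x + 1), ← ih (x - 1), add_comm, neg_add', neg_sub', sub_neg_eq_add]

theorem abs_rn_le_one (n : ℕ) (x : ℤ) : |rn n x| ≤ 1 := by
  induction n generalizing x with
  | zero => rw [rn_zero]; split_ifs <;> simp
  | succ n ih =>
    rw [rn_succ]
    have h1 := abs_le.1 (ih (x + 1))
    have h2 := abs_le.1 (ih (x - 1))
    rw [abs_le]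
    constructor <;> linarith

theorem abs_pow_div_factorial_mul_le {a : ℕ → ℝ} (ha : ∀ n, |a n| ≤ 1) (t : ℝ) (n : ℕ) :
    |t ^ n / n.factorial * a n| ≤ |t| ^ n / n.factorial := by
  rw [abs_mul, abs_div, abs_pow, Nat.abs_cast]
  exact mul_le_of_le_one_right (by positivity) (ha n)

theorem summable_pow_div_factorial_mul {a : ℕ → ℝ} (ha : ∀ n, |a n| ≤ 1) (t : ℝ) :
    Summable fun n : ℕ => t ^ n / n.factorial * a n :=
  .of_norm_bounded (Real.summable_pow_div_factorial |t|) (abs_pow_div_factorial_mul_le ha t)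

/-- Differentiating an exponential generating function shifts its coefficients. -/
theorem hasDerivAt_tsum_pow_div_factorial_mul {a : ℕ → ℝ} (ha : ∀ n, |a n| ≤ 1) (t : ℝ) :
    HasDerivAt (fun s : ℝ => ∑' n : ℕ, s ^ n / n.factorial * a n)
      (∑' n : ℕ, t ^ n / n.factorial * a (n + 1)) t := by
  have hshift (s : ℝ) (n : ℕ) :
      ((n + 1 : ℕ) : ℝ) * s ^ n / (n + 1).factorial = s ^ n / n.factorial := by
    rw [Nat.factorial_succ]
    push_cast
    field_simp
  have hu : Summable fun n : ℕ => (n : ℝ) * (|t| + 1) ^ (n - 1) / n.factorial := by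
    rw [← summable_nat_add_iff 1]
    simpa only [Nat.add_sub_cancel, hshift] using Real.summable_pow_div_factorial (|t| + 1)
  have hbound (n : ℕ) (s : ℝ) (hs : s ∈ Metric.ball (0 : ℝ) (|t| + 1)) :
      ‖(n : ℝ) * s ^ (n - 1) / n.factorial * a n‖ ≤
        (n : ℝ) * (|t| + 1) ^ (n - 1) / n.factorial := by
    have hs' : |s| ≤ |t| + 1 := by simpa using (mem_ball_zero_iff.1 hs).le
    rw [Real.norm_eq_abs, abs_mul, abs_div, abs_mul, abs_pow, Nat.abs_cast, Nat.abs_cast]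
    refine (mul_le_of_le_one_right (by positivity) (ha n)).trans ?_
    gcongr
  have ht : t ∈ Metric.ball (0 : ℝ) (|t| + 1) := by simp
  have key := hasDerivAt_tsum_of_isPreconnected
    (g := fun (n : ℕ) (s : ℝ) => s ^ n / n.factorial * a n)
    (g' := fun (n : ℕ) (s : ℝ) => (n : ℝ) * s ^ (n - 1) / n.factorial * a n) hu
    Metric.isOpen_ball (convex_ball (0 : ℝ) (|t| + 1)).isPreconnected
    (fun n s _ => ((hasDerivAt_pow n s).div_const _).mul_const _) hbound ht
    (summable_pow_div_factorial_mul ha t) ht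
  refine key.congr_deriv ?_
  rw [(Summable.of_norm_bounded hu fun n => hbound n t ht).tsum_eq_zero_add]
  simp only [Nat.add_sub_cancel, hshift]
  simp

theorem pline_eq (t : ℝ) (x : ℤ) :
    pline t x = Real.exp (-t) * ∑' n : ℕ, t ^ n / n.factorial * rn n x := by
  rw [pline, ← tsum_mul_left]
  congr 1
  ext n
  ring

theorem pline_neg (t : ℝ) (x : ℤ) : pline t (-x) = pline t x := by
  simp only [pline, rn_neg]

theorem pline_zero (x : ℤ) : pline 0 x = if x = 0 then 1 else 0 := by
  rw [pline, tsum_eq_single 0]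
  · simp [rn_zero]
  · intro n hn
    simp [hn]

theorem abs_pline_le (t : ℝ) (x : ℤ) : |pline t x| ≤ Real.exp (2 * |t|) := by
  have h : |∑' n : ℕ, t ^ n / n.factorial * rn n x| ≤ Real.exp |t| := by
    rw [Real.exp_eq_exp_ℝ, NormedSpace.exp_eq_tsum_div]
    rw [← Real.norm_eq_abs]
    exact tsum_of_norm_bounded (Real.summable_pow_div_factorial |t|).hasSum
      (abs_pow_div_factorial_mul_le (abs_rn_le_one · x) t)
  rw [pline_eq, abs_mul, Real.abs_exp, two_mul, Real.exp_add]
  gcongr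
  exact neg_le_abs t

/-- The heat equation for the continuous-time random walk kernel on `ℤ`. -/
theorem hasDerivAt_pline (t : ℝ) (x : ℤ) :
    HasDerivAt (fun s => pline s x)
      ((1 / 2) * (pline t (x + 1) + pline t (x - 1) - 2 * pline t x)) t := by
  have hexp : HasDerivAt (fun s : ℝ => Real.exp (-s)) (-Real.exp (-t)) t := by
    simpa using (hasDerivAt_neg t).exp
  have h := hexp.mul (hasDerivAt_tsum_pow_div_factorial_mul (abs_rn_le_one · x) t)
  have hsum : ∑' n : ℕ, t ^ n / n.factorial * rn (n + 1) x =
      (∑' n : ℕ, t ^ n / n.factorial * rn n (x + 1) +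
        ∑' n : ℕ, t ^ n / n.factorial * rn n (x - 1)) / 2 := by
    rw [← (summable_pow_div_factorial_mul (abs_rn_le_one · (x + 1)) t).tsum_add
      (summable_pow_div_factorial_mul (abs_rn_le_one · (x - 1)) t), ← tsum_div_const]
    congr 1
    ext n
    rw [rn_succ]
    ring
  rw [hsum] at h
  simp only [pline_eq]
  refine h.congr_deriv ?_
  ring

theorem summable_pow_add_two {μ : ℝ} (hμ : μ ∈ Set.Ioo (0 : ℝ) 1) :
    Summable fun z : ℕ => μ ^ (z + 2) :=
  (summable_nat_add_iff 2).2 (summable_geometric_of_lt_one hμ.1.le hμ.2)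

theorem summable_pow_mul_pline {μ : ℝ} (hμ : μ ∈ Set.Ioo (0 : ℝ) 1) (t : ℝ) (x : ℤ) :
    Summable fun z : ℕ => μ ^ (z + 2) * pline t (x + (z + 2)) := by
  refine .of_norm_bounded ((summable_pow_add_two hμ).mul_right (Real.exp (2 * |t|))) fun z => ?_
  have := hμ.1
  rw [Real.norm_eq_abs, abs_mul, abs_of_pos (pow_pos this _)]
  gcongr
  exact abs_pline_le t _

theorem hasDerivAt_tsum_pow_mul_pline {μ : ℝ} (hμ : μ ∈ Set.Ioo (0 : ℝ) 1) (t : ℝ) (x : ℤ) :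
    HasDerivAt (fun s => ∑' z : ℕ, μ ^ (z + 2) * pline s (x + (z + 2)))
      ((1 / 2) * (∑' z : ℕ, μ ^ (z + 2) * pline t (x + 1 + (z + 2)) +
        ∑' z : ℕ, μ ^ (z + 2) * pline t (x - 1 + (z + 2)) -
        2 * ∑' z : ℕ, μ ^ (z + 2) * pline t (x + (z + 2)))) t := by
  have hpos := hμ.1
  have ht : t ∈ Metric.ball (0 : ℝ) (|t| + 1) := by simp
  have key := hasDerivAt_tsum_of_isPreconnected
    (g := fun (z : ℕ) (s : ℝ) => μ ^ (z + 2) * pline s (x + (z + 2)))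
    (g' := fun (z : ℕ) (s : ℝ) => μ ^ (z + 2) * ((1 / 2) * (pline s (x + (z + 2) + 1) +
      pline s (x + (z + 2) - 1) - 2 * pline s (x + (z + 2)))))
    ((summable_pow_add_two hμ).mul_right (2 * Real.exp (2 * (|t| + 1))))
    Metric.isOpen_ball (convex_ball (0 : ℝ) (|t| + 1)).isPreconnected
    (fun z s _ => (hasDerivAt_pline s _).const_mul _) ?_ ht
    (summable_pow_mul_pline hμ t x) ht
  · refine key.congr_deriv ?_
    symm
    rw [← (summable_pow_mul_pline hμ t (x + 1)).tsum_add (summable_pow_mul_pline hμ t (x - 1)),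
      ← tsum_mul_left, ← Summable.tsum_sub, ← tsum_mul_left]
    · congr 1
      ext z
      rw [add_right_comm x 1, sub_add_eq_add_sub x 1]
      ring
    · exact (summable_pow_mul_pline hμ t (x + 1)).add (summable_pow_mul_pline hμ t (x - 1))
    · exact (summable_pow_mul_pline hμ t x).mul_left 2
  · intro z s hs
    have hs' : |s| ≤ |t| + 1 := by simpa using (mem_ball_zero_iff.1 hs).le
    have hb (y : ℤ) : |pline s y| ≤ Real.exp (2 * (|t| + 1)) :=
      (abs_pline_le s y).trans (by gcongr)
    rw [Real.norm_eq_abs, abs_mul, abs_of_pos (pow_pos hpos _)]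
    gcongr
    have h1 := abs_le.1 (hb (x + (z + 2) + 1))
    have h2 := abs_le.1 (hb (x + (z + 2) - 1))
    have h3 := abs_le.1 (hb (x + (z + 2)))
    rw [abs_le]
    constructor <;> linarith

theorem hasDerivAt_Fker {μ : ℝ} (hμ : μ ∈ Set.Ioo (0 : ℝ) 1) (t : ℝ) (x : ℤ) (y : ℕ) :
    HasDerivAt (fun s : ℝ => Fker μ s x y)
      ((1 / 2) * (Fker μ t (x + 1) y + Fker μ t (x - 1) y - 2 * Fker μ t x y)) t := by
  have h := ((hasDerivAt_pline t (x - y)).add ((hasDerivAt_pline t (x + y + 1)).const_mul μ)).add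
    ((hasDerivAt_tsum_pow_mul_pline hμ t (x + y)).const_mul (1 - μ ^ (-2 : ℤ)))
  unfold Fker
  refine h.congr_deriv ?_
  rw [show x + 1 - (y : ℤ) = x - y + 1 by ring, show x - 1 - (y : ℤ) = x - y - 1 by ring,
    show x + 1 + (y : ℤ) = x + y + 1 by ring, show x - 1 + (y : ℤ) = x + y - 1 by ring,
    show x + (y : ℤ) - 1 + 1 = x + y + 1 - 1 by ring]
  ring

theorem Fker_zero (μ : ℝ) (x y : ℕ) :
    Fker μ 0 x y = if (x : ℤ) = (y : ℤ) then 1 else 0 := by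
  have h1 : ¬ ((x : ℤ) + y + 1 = 0) := by omega
  have h2 (z : ℕ) : ¬ ((x : ℤ) + y + (z + 2) = 0) := by omega
  simp only [Fker, pline_zero, h1, h2, sub_eq_zero, if_false, mul_zero, tsum_zero, add_zero]

/-- The Robin boundary condition for the images-method kernel. -/
theorem Fker_neg_one {μ : ℝ} (hμ : μ ∈ Set.Ioo (0 : ℝ) 1) (t : ℝ) (y : ℕ) :
    Fker μ t (-1) y = μ * Fker μ t 0 y := by
  have hne : μ ≠ 0 := hμ.1.ne'
  have hsum : ∑' z : ℕ, μ ^ (z + 2) * pline t (-1 + y + (z + 2)) =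
      μ ^ 2 * pline t (y + 1) + μ * ∑' z : ℕ, μ ^ (z + 2) * pline t (0 + y + (z + 2)) := by
    rw [(summable_pow_mul_pline hμ t (-1 + y)).tsum_eq_zero_add, ← tsum_mul_left]
    congr 1
    · rw [zero_add, show -1 + (y : ℤ) + ((0 : ℕ) + 2) = y + 1 by push_cast; ring]
    · congr 1
      ext z
      rw [show -1 + (y : ℤ) + ((z + 1 : ℕ) + 2) = 0 + y + (z + 2) by push_cast; ring]
      ring
  unfold Fker
  rw [hsum, show -1 - (y : ℤ) = -(y + 1) by ring, pline_neg, zero_sub, pline_neg,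
    show -1 + (y : ℤ) + 1 = y by ring, zero_add, zpow_neg]
  norm_cast
  field_simp
  ring

theorem stmt12 (μ : ℝ) (hμ : μ ∈ Set.Ioo (0 : ℝ) 1) :
    (∀ (t : ℝ) (x : ℤ) (y : ℕ), 0 ≤ t → -1 ≤ x →
      Summable (fun z : ℕ => μ ^ (z + 2) * pline t (x + y + (z + 2)))) ∧
    (∀ x y : ℕ, Fker μ 0 x y = if (x : ℤ) = (y : ℤ) then 1 else 0) ∧
    (∀ (x y : ℕ) (t : ℝ), 0 ≤ t →
      HasDerivAt (fun s : ℝ => Fker μ s x y)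
        ((1 / 2) * (Fker μ t ((x : ℤ) + 1) y + Fker μ t ((x : ℤ) - 1) y - 2 * Fker μ t x y)) t) ∧
    (∀ (t : ℝ) (y : ℕ), 0 ≤ t → Fker μ t (-1) y = μ * Fker μ t 0 y) := by
  exact ⟨fun t x y _ _ => summable_pow_mul_pline hμ t (x + y), Fker_zero μ,
    fun x y t _ => hasDerivAt_Fker hμ t x y, fun t y _ => Fker_neg_one hμ t y⟩
end

section
/- For all t > 0 and u > 0, define Φ(t,u) = e^{−u} ( √π e^{t/4} √t ( e^u (erf(√t/2)+1)(t(u−1)+2u²) + t e^{u²/t} (erf((t−2u)/(2√t))+1) ) + 2 e^u u (t+2u) ) / (4u²). Then 0 ≤ Φ(t,u) ≤ (1/8)·( √π · e^{t/4} · √t · (t+6) · (erf(√t/2) + 1) + 2(t+4) ). -/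
open MeasureTheory Real

/-- The error function `erf(x) = (2/√π) ∫₀ˣ e^{−s²} ds`. -/
noncomputable def erf (x : ℝ) : ℝ :=
  (2 / Real.sqrt Real.pi) * ∫ s in (0 : ℝ)..x, Real.exp (-s ^ 2)

theorem erf_neg (x : ℝ) : erf (-x) = -erf x := by
  have h := intervalIntegral.integral_comp_neg (a := 0) (b := x)
    (fun s : ℝ => Real.exp (-s ^ 2))
  simp only [neg_sq, neg_zero] at h
  rw [erf, erf, h, intervalIntegral.integral_symm]
  ring

theorem hasDerivAt_erf (x : ℝ) :
    HasDerivAt erf (2 / Real.sqrt Real.pi * Real.exp (-x ^ 2)) x := by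
  have hc : Continuous fun s : ℝ => Real.exp (-s ^ 2) := by fun_prop
  exact (intervalIntegral.integral_hasDerivAt_right (hc.intervalIntegrable _ _)
    hc.stronglyMeasurable.stronglyMeasurableAtFilter hc.continuousAt).const_mul _

theorem erf_nonneg {x : ℝ} (hx : 0 ≤ x) : 0 ≤ erf x :=
  mul_nonneg (by positivity)
    (intervalIntegral.integral_nonneg hx fun _ _ => (Real.exp_pos _).le)

theorem tendsto_erf_atTop : Filter.Tendsto erf Filter.atTop (nhds 1) := by
  have hint : Integrable fun s : ℝ => Real.exp (-s ^ 2) := by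
    simpa using integrable_exp_neg_mul_sq (b := 1) one_pos
  have hval : ∫ s in Set.Ioi (0 : ℝ), Real.exp (-s ^ 2) = Real.sqrt Real.pi / 2 := by
    simpa using integral_gaussian_Ioi 1
  have h := (intervalIntegral_tendsto_integral_Ioi 0 hint.integrableOn
    Filter.tendsto_id).const_mul (2 / Real.sqrt Real.pi)
  have hpi : Real.sqrt Real.pi ≠ 0 := (Real.sqrt_pos.2 Real.pi_pos).ne'
  rw [hval, show 2 / Real.sqrt Real.pi * (Real.sqrt Real.pi / 2) = 1 by field_simp] at h
  exact h

theorem tendsto_erf_atBot : Filter.Tendsto erf Filter.atBot (nhds (-1)) := by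
  refine (tendsto_erf_atTop.comp Filter.tendsto_neg_atBot_atTop).neg.congr fun x => ?_
  simp [erf_neg]

theorem exp_neg_le_quadratic {x : ℝ} (hx : 0 ≤ x) : Real.exp (-x) ≤ 1 - x + x ^ 2 / 2 := by
  have h := Real.quadratic_le_exp_of_nonneg hx
  rw [Real.exp_neg, inv_le_iff_one_le_mul₀ (Real.exp_pos x)]
  have hq : 0 ≤ 1 - x + x ^ 2 / 2 := by nlinarith [sq_nonneg (x - 1)]
  nlinarith [mul_le_mul_of_nonneg_left h hq, sq_nonneg (x ^ 2)]

/-- A primitive of `-2 exp (v - v ^ 2 / t)`. -/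
noncomputable def scaledErf (t v : ℝ) : ℝ :=
  Real.sqrt Real.pi * Real.exp (t / 4) * Real.sqrt t * erf ((t - 2 * v) / (2 * Real.sqrt t))

theorem hasDerivAt_scaledErf {t : ℝ} (ht : 0 < t) (v : ℝ) :
    HasDerivAt (scaledErf t) (-2 * Real.exp (v - v ^ 2 / t)) v := by
  have hs : 0 < Real.sqrt t := Real.sqrt_pos.2 ht
  have hpi : 0 < Real.sqrt Real.pi := Real.sqrt_pos.2 Real.pi_pos
  have hlin : HasDerivAt (fun v : ℝ => (t - 2 * v) / (2 * Real.sqrt t))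
      (-(2 * 1) / (2 * Real.sqrt t)) v :=
    (((hasDerivAt_id v).const_mul 2).const_sub t).div_const _
  have h := ((hasDerivAt_erf _).comp v hlin).const_mul
    (Real.sqrt Real.pi * Real.exp (t / 4) * Real.sqrt t)
  refine h.congr_deriv ?_
  have he : Real.exp (v - v ^ 2 / t) =
      Real.exp (t / 4) * Real.exp (-((t - 2 * v) / (2 * Real.sqrt t)) ^ 2) := by
    rw [← Real.exp_add, div_pow, mul_pow, Real.sq_sqrt ht.le]
    congr 1
    field_simp
    ring
  rw [he]
  field_simp

theorem tendsto_scaledErf {t : ℝ} (ht : 0 < t) :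
    Filter.Tendsto (scaledErf t) Filter.atTop
      (nhds (-(Real.sqrt Real.pi * Real.exp (t / 4) * Real.sqrt t))) := by
  have hs : 0 < Real.sqrt t := Real.sqrt_pos.2 ht
  have hlin : Filter.Tendsto (fun v : ℝ => (t - 2 * v) / (2 * Real.sqrt t))
      Filter.atTop Filter.atBot := by
    refine Filter.Tendsto.atBot_div_const (by positivity) ?_
    exact Filter.tendsto_atBot_add_const_left _ t
      (Filter.tendsto_neg_atTop_atBot.comp (Filter.tendsto_id.const_mul_atTop two_pos))
  have h := (tendsto_erf_atBot.comp hlin).const_mul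
    (Real.sqrt Real.pi * Real.exp (t / 4) * Real.sqrt t)
  rw [mul_neg_one] at h
  exact h

theorem hasDerivAt_exp_sub_sq_div (t v : ℝ) :
    HasDerivAt (fun v : ℝ => Real.exp (v - v ^ 2 / t))
      (Real.exp (v - v ^ 2 / t) * (1 - 2 * v / t)) v := by
  simpa using ((hasDerivAt_id v).sub ((hasDerivAt_pow 2 v).div_const t)).exp

theorem tendsto_pow_mul_exp_sub_sq_div {t : ℝ} (ht : 0 < t) (n : ℕ) :
    Filter.Tendsto (fun v : ℝ => v ^ n * Real.exp (v - v ^ 2 / t)) Filter.atTop (nhds 0) := by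
  refine tendsto_of_tendsto_of_tendsto_of_le_of_le' tendsto_const_nhds
    (Real.tendsto_pow_mul_exp_neg_atTop_nhds_zero n) ?_ ?_
  · filter_upwards [Filter.eventually_ge_atTop 0] with v hv
    positivity
  · filter_upwards [Filter.eventually_ge_atTop (2 * t)] with v hv
    have hv0 : 0 ≤ v := by linarith
    gcongr
    have : 2 * v ≤ v ^ 2 / t := by
      rw [le_div_iff₀ ht]
      nlinarith
    linarith

theorem le_of_tendsto_of_hasDerivAt_nonneg {f f' : ℝ → ℝ} {a l : ℝ}
    (hf : ∀ x, HasDerivAt f (f' x) x) (hf' : ∀ x, a < x → 0 ≤ f' x)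
    (hl : Filter.Tendsto f Filter.atTop (nhds l)) : f a ≤ l := by
  have hmono : MonotoneOn f (Set.Ici a) := by
    refine monotoneOn_of_hasDerivWithinAt_nonneg (f' := f') (convex_Ici a)
      (fun x _ => (hf x).continuousAt.continuousWithinAt)
      (fun x _ => (hf x).hasDerivWithinAt) fun x hx => ?_
    rw [interior_Ici] at hx
    exact hf' x hx
  refine ge_of_tendsto hl ?_
  filter_upwards [Filter.eventually_ge_atTop a] with x hx
  exact hmono Set.self_mem_Ici hx hx

/-- A primitive of `r * exp (r - r ^ 2 / t)`. -/
noncomputable def firstMoment (t r : ℝ) : ℝ :=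
  t / 2 * (-scaledErf t r / 2 - Real.exp (r - r ^ 2 / t))

/-- A primitive of `r ^ 2 * exp (r - r ^ 2 / t)`. -/
noncomputable def secondMoment (t r : ℝ) : ℝ :=
  t / 2 * (-scaledErf t r / 2 + firstMoment t r - r * Real.exp (r - r ^ 2 / t))

/-- A primitive of `exp (r - r ^ 2 / t) * (exp (-x) - 1 + x)`, where `x = 2 * u * r / t`. -/
noncomputable def remainderPrimitive (t u r : ℝ) : ℝ :=
  -(Real.exp (u ^ 2 / t - u) * scaledErf t (r + u)) / 2 + scaledErf t r / 2 +
    2 * u / t * firstMoment t r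

section Primitives

variable {t : ℝ}

theorem hasDerivAt_firstMoment (ht : 0 < t) (r : ℝ) :
    HasDerivAt (firstMoment t) (r * Real.exp (r - r ^ 2 / t)) r := by
  refine ((((hasDerivAt_scaledErf ht r).neg.div_const 2).sub
    (hasDerivAt_exp_sub_sq_div t r)).const_mul (t / 2)).congr_deriv ?_
  field_simp
  ring

theorem hasDerivAt_secondMoment (ht : 0 < t) (r : ℝ) :
    HasDerivAt (secondMoment t) (r ^ 2 * Real.exp (r - r ^ 2 / t)) r := by
  refine (((((hasDerivAt_scaledErf ht r).neg.div_const 2).add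
    (hasDerivAt_firstMoment ht r)).sub
    ((hasDerivAt_id r).mul (hasDerivAt_exp_sub_sq_div t r))).const_mul (t / 2)).congr_deriv ?_
  simp only [id]
  field_simp
  ring

theorem hasDerivAt_remainderPrimitive (ht : 0 < t) (u r : ℝ) :
    HasDerivAt (remainderPrimitive t u) (Real.exp (r - r ^ 2 / t) *
      (Real.exp (-(2 * u * r / t)) - 1 + 2 * u * r / t)) r := by
  refine ((((((hasDerivAt_scaledErf ht (r + u)).comp_add_const r u).const_mul
    (Real.exp (u ^ 2 / t - u))).neg.div_const 2).add
    ((hasDerivAt_scaledErf ht r).div_const 2)).add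
    ((hasDerivAt_firstMoment ht r).const_mul (2 * u / t))).congr_deriv ?_
  have he : Real.exp (u ^ 2 / t - u) * Real.exp (r + u - (r + u) ^ 2 / t) =
      Real.exp (r - r ^ 2 / t) * Real.exp (-(2 * u * r / t)) := by
    rw [← Real.exp_add, ← Real.exp_add]
    congr 1
    field_simp
    ring
  linear_combination he

theorem tendsto_firstMoment (ht : 0 < t) :
    Filter.Tendsto (firstMoment t) Filter.atTop
      (nhds (t / 2 * (Real.sqrt Real.pi * Real.exp (t / 4) * Real.sqrt t / 2))) := by
  have h0 := tendsto_pow_mul_exp_sub_sq_div ht 0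
  simp only [pow_zero, one_mul] at h0
  have h := (((tendsto_scaledErf ht).neg.div_const 2).sub h0).const_mul (t / 2)
  rw [neg_neg, sub_zero] at h
  exact h

theorem tendsto_secondMoment (ht : 0 < t) :
    Filter.Tendsto (secondMoment t) Filter.atTop
      (nhds (t / 2 * (Real.sqrt Real.pi * Real.exp (t / 4) * Real.sqrt t / 2 +
        t / 2 * (Real.sqrt Real.pi * Real.exp (t / 4) * Real.sqrt t / 2)))) := by
  have h1 := tendsto_pow_mul_exp_sub_sq_div ht 1
  simp only [pow_one] at h1
  have h := ((((tendsto_scaledErf ht).neg.div_const 2).add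
    (tendsto_firstMoment ht)).sub h1).const_mul (t / 2)
  rw [neg_neg, sub_zero] at h
  exact h

theorem tendsto_remainderPrimitive (ht : 0 < t) (u : ℝ) :
    Filter.Tendsto (remainderPrimitive t u) Filter.atTop
      (nhds (Real.sqrt Real.pi * Real.exp (t / 4) * Real.sqrt t / 2 *
        (Real.exp (u ^ 2 / t - u) - 1 + u))) := by
  have hshift := (tendsto_scaledErf ht).comp (Filter.tendsto_atTop_add_const_right _ u
    Filter.tendsto_id)
  have h := (((hshift.const_mul (Real.exp (u ^ 2 / t - u))).neg.div_const 2).add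
    ((tendsto_scaledErf ht).div_const 2)).add ((tendsto_firstMoment ht).const_mul (2 * u / t))
  have hlim : ∀ a : ℝ, a / 2 * (Real.exp (u ^ 2 / t - u) - 1 + u) =
      -(Real.exp (u ^ 2 / t - u) * -a) / 2 + -a / 2 + 2 * u / t * (t / 2 * (a / 2)) := by
    intro a
    field_simp
    ring
  rw [hlim]
  exact h

theorem remainderPrimitive_zero_le (ht : 0 < t) (u : ℝ) :
    remainderPrimitive t u 0 ≤ Real.sqrt Real.pi * Real.exp (t / 4) * Real.sqrt t / 2 *
      (Real.exp (u ^ 2 / t - u) - 1 + u) := by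
  refine le_of_tendsto_of_hasDerivAt_nonneg (hasDerivAt_remainderPrimitive ht u)
    (fun r _ => mul_nonneg (Real.exp_pos _).le ?_) (tendsto_remainderPrimitive ht u)
  linarith [Real.one_sub_le_exp_neg (2 * u * r / t)]

theorem secondMoment_sub_remainderPrimitive_zero_le (ht : 0 < t) {u : ℝ} (hu : 0 < u) :
    2 * u ^ 2 / t ^ 2 * secondMoment t 0 - remainderPrimitive t u 0 ≤
      2 * u ^ 2 / t ^ 2 *
        (t / 2 * (Real.sqrt Real.pi * Real.exp (t / 4) * Real.sqrt t / 2 +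
          t / 2 * (Real.sqrt Real.pi * Real.exp (t / 4) * Real.sqrt t / 2))) -
      Real.sqrt Real.pi * Real.exp (t / 4) * Real.sqrt t / 2 *
        (Real.exp (u ^ 2 / t - u) - 1 + u) := by
  refine le_of_tendsto_of_hasDerivAt_nonneg
    (f := fun r => 2 * u ^ 2 / t ^ 2 * secondMoment t r - remainderPrimitive t u r)
    (fun r => ((hasDerivAt_secondMoment ht r).const_mul _).sub
      (hasDerivAt_remainderPrimitive ht u r)) (fun r hr => ?_)
    (((tendsto_secondMoment ht).const_mul _).sub (tendsto_remainderPrimitive ht u))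
  have hq := exp_neg_le_quadratic (x := 2 * u * r / t) (by positivity)
  have hx : (2 * u * r / t) ^ 2 / 2 = 2 * u ^ 2 / t ^ 2 * r ^ 2 := by
    field_simp
  rw [hx] at hq
  have := mul_le_mul_of_nonneg_left hq (Real.exp_pos (r - r ^ 2 / t)).le
  linarith

end Primitives

theorem stmt19 (t u : ℝ) (ht : 0 < t) (hu : 0 < u) :
    let Φ := Real.exp (-u) *
        (Real.sqrt Real.pi * Real.exp (t / 4) * Real.sqrt t *
            (Real.exp u * (erf (Real.sqrt t / 2) + 1) * (t * (u - 1) + 2 * u ^ 2) +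
              t * Real.exp (u ^ 2 / t) * (erf ((t - 2 * u) / (2 * Real.sqrt t)) + 1)) +
          2 * Real.exp u * u * (t + 2 * u)) / (4 * u ^ 2)
    0 ≤ Φ ∧
      Φ ≤ (1 / 8) * (Real.sqrt Real.pi * Real.exp (t / 4) * Real.sqrt t * (t + 6) *
          (erf (Real.sqrt t / 2) + 1) + 2 * (t + 4)) := by
  intro Φ
  have hs : 0 < Real.sqrt t := Real.sqrt_pos.2 ht
  have hlower := remainderPrimitive_zero_le ht u
  have hupper := secondMoment_sub_remainderPrimitive_zero_le ht hu
  have hlin : (t - 2 * 0) / (2 * Real.sqrt t) = Real.sqrt t / 2 := by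
    rw [div_eq_div_iff (by positivity) two_ne_zero]
    linear_combination -2 * Real.mul_self_sqrt ht.le
  have he : Real.exp (-u) * Real.exp u = 1 := by rw [← Real.exp_add]; simp
  have heu : Real.exp (u ^ 2 / t - u) = Real.exp (-u) * Real.exp (u ^ 2 / t) := by
    rw [← Real.exp_add]
    congr 1
    ring
  simp only [remainderPrimitive, secondMoment, firstMoment, scaledErf, hlin, heu, zero_add,
    sub_self, zero_div, ne_eq, OfNat.ofNat_ne_zero, not_false_eq_true, zero_pow, Real.exp_zero,
    zero_mul, sub_zero] at hlower hupper
  set A := Real.sqrt Real.pi * Real.exp (t / 4) * Real.sqrt t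
  have hApos : 0 < A := by positivity
  set G := erf ((t - 2 * u) / (2 * Real.sqrt t))
  set E := erf (Real.sqrt t / 2)
  have hE : 0 ≤ E := erf_nonneg (by positivity)
  have hΦ : Φ = (A * ((E + 1) * (t * (u - 1) + 2 * u ^ 2) +
      t * (Real.exp (-u) * Real.exp (u ^ 2 / t)) * (G + 1)) + 2 * u * (t + 2 * u)) /
        (4 * u ^ 2) := by
    simp only [Φ]
    congr 1
    linear_combination (A * (E + 1) * (t * (u - 1) + 2 * u ^ 2) + 2 * u * (t + 2 * u)) * he
  set W := Real.exp (-u) * Real.exp (u ^ 2 / t)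
  have hfirst : ∀ x : ℝ, 2 * u / t * (t / 2 * x) = u * x := fun x => by field_simp
  have hsecond : ∀ x : ℝ, 2 * u ^ 2 / t ^ 2 * (t / 2 * x) = u ^ 2 * x / t :=
    fun x => by field_simp
  rw [hfirst] at hlower hupper
  rw [hsecond, hsecond, sub_le_sub_iff, ← sub_nonneg] at hupper
  rw [hΦ]
  have hlower' := mul_nonneg ht.le (sub_nonneg.2 hlower)
  have hupper' := mul_nonneg ht.le hupper
  field_simp at hupper'
  constructor
  · refine div_nonneg ?_ (by positivity)
    have hmain : 0 ≤ A * (E + 1) * u ^ 2 := by positivity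
    nlinarith
  · rw [div_le_iff₀ (by positivity)]
    linarith
end
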